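/- Let ρ : Γ → G be a strictly type preserving isomorphism of finitely generated Kleinian groups, with Γ convex cocompact. Let O ∈ ℍ³ be a base point, not fixed by any nontrivial element of Γ or G, lying in the convex hull of Λ_Γ. Then the Cannon–Thurston map Λ_Γ → Λ_G exists if and only if there exists a function f : ℕ → ℕ with f(M) → ∞ as M → ∞, such that whenever λ is an ℍ³-geodesic segment contained in the convex hull of Λ_Γ with endpoints X = γ·O and Y = γ′·O in the orbit Γ·O such that λ lies outside the hyperbolic ball B(O; M), the ℍ³-geodesic segment from ρ(γ)·O to ρ(γ′)·O lies outside B(O; f(M)). -/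

import Mathlib

/- Background framework: hyperbolic 3-space (upper half-space model), `PSL(2,ℂ)` and its
actions on `ℍ³` and on the Riemann sphere `Ĉ = ℂ ∪ {∞}`, limit sets, Kleinian groups,
Cannon–Thurston maps, and the various convergence notions. -/

noncomputable section

open scoped Topology
open OnePoint

/-- `SL(2,ℂ)`. -/
abbrev SL2C := Matrix.SpecialLinearGroup (Fin 2) ℂ

instance : TopologicalSpace SL2C :=
  TopologicalSpace.induced (fun g => (g : Matrix (Fin 2) (Fin 2) ℂ)) inferInstance

/-- `PSL(2,ℂ)`, the quotient of `SL(2,ℂ)` by its center `{±I}`. -/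
abbrev PSL2C := SL2C ⧸ Subgroup.center SL2C

/-- Hyperbolic 3-space, in the upper half-space model `{(z,t) : z ∈ ℂ, t > 0}`. -/
abbrev H3 := {p : ℂ × ℝ // 0 < p.2}

/-- Inverse hyperbolic cosine. -/
def arcosh (x : ℝ) : ℝ := Real.log (x + Real.sqrt (x ^ 2 - 1))

/-- The hyperbolic distance on the upper half-space model:
`cosh (d3 p q) = 1 + (|z₁-z₂|² + (t₁-t₂)²)/(2 t₁ t₂)`. -/
def d3 (p q : H3) : ℝ :=
  arcosh (1 + (‖p.1.1 - q.1.1‖ ^ 2 + (p.1.2 - q.1.2) ^ 2) / (2 * p.1.2 * q.1.2))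

lemma denom_pos (g : SL2C) (z : ℂ) (t : ℝ) (ht : 0 < t) :
    0 < Complex.normSq (g.1 1 0 * z + g.1 1 1) + Complex.normSq (g.1 1 0) * t ^ 2 := by
  rcases eq_or_ne (g.1 1 0) 0 with hc | hc
  · have hd : g.1 1 1 ≠ 0 := by
      intro hd
      have h := g.2
      rw [Matrix.det_fin_two] at h
      rw [hc, hd] at h
      simp at h
    have h1 : 0 < Complex.normSq (g.1 1 0 * z + g.1 1 1) := by
      rw [hc]
      simpa using Complex.normSq_pos.mpr hd
    nlinarith [Complex.normSq_nonneg (g.1 1 0), sq_nonneg t]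
  · have h2 : 0 < Complex.normSq (g.1 1 0) * t ^ 2 := by
      have := Complex.normSq_pos.mpr hc
      positivity
    nlinarith [Complex.normSq_nonneg (g.1 1 0 * z + g.1 1 1)]

/-- The isometric action of `SL(2,ℂ)` on the upper half-space (the Poincaré extension of
the Möbius action, given by the standard quaternionic formula). -/
def act3SL (g : SL2C) (p : H3) : H3 :=
  ⟨((((g.1 0 0) * p.1.1 + g.1 0 1) * (starRingEnd ℂ) ((g.1 1 0) * p.1.1 + g.1 1 1) +
      (g.1 0 0) * (starRingEnd ℂ) (g.1 1 0) * (p.1.2 : ℂ) ^ 2) /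
      ((Complex.normSq ((g.1 1 0) * p.1.1 + g.1 1 1) + Complex.normSq (g.1 1 0) * p.1.2 ^ 2 : ℝ) : ℂ),
    p.1.2 / (Complex.normSq ((g.1 1 0) * p.1.1 + g.1 1 1) + Complex.normSq (g.1 1 0) * p.1.2 ^ 2)),
    div_pos p.2 (denom_pos g p.1.1 p.1.2 p.2)⟩

/-- The action of `PSL(2,ℂ)` on hyperbolic 3-space.  (The `SL(2,ℂ)`-action is invariant
under the center, so the value does not depend on the choice of representative.) -/
def act3 (q : PSL2C) : H3 → H3 := act3SL q.out

/-- The Möbius action of `SL(2,ℂ)` on the Riemann sphere `Ĉ = ℂ ∪ {∞}`. -/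
def mobiusSL (g : SL2C) : OnePoint ℂ → OnePoint ℂ := fun x =>
  Option.elim x
    (if g.1 1 0 = 0 then (∞ : OnePoint ℂ) else ((g.1 0 0 / g.1 1 0 : ℂ) : OnePoint ℂ))
    (fun z => if g.1 1 0 * z + g.1 1 1 = 0 then (∞ : OnePoint ℂ)
      else (((g.1 0 0 * z + g.1 0 1) / (g.1 1 0 * z + g.1 1 1) : ℂ) : OnePoint ℂ))

/-- The Möbius action of `PSL(2,ℂ)` on the Riemann sphere. -/
def actS (q : PSL2C) : OnePoint ℂ → OnePoint ℂ := mobiusSL q.out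

/-- The inclusion of the upper half-space into the one-point compactification of `ℂ × ℝ`;
together with `iBd` this realizes the compactification `ℍ³ ∪ Ĉ`. -/
def iH3 : H3 → OnePoint (ℂ × ℝ) := fun p => (p.1 : OnePoint (ℂ × ℝ))

/-- The inclusion of the Riemann sphere `Ĉ` as the boundary `{t = 0} ∪ {∞}` of the closure
of the upper half-space in the one-point compactification of `ℂ × ℝ`. -/
def iBd : OnePoint ℂ → OnePoint (ℂ × ℝ) := fun ξ =>
  Option.elim ξ (∞ : OnePoint (ℂ × ℝ)) (fun z => (((z, (0 : ℝ)) : ℂ × ℝ) : OnePoint (ℂ × ℝ)))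

/-- The limit set of a subgroup `Γ ≤ PSL(2,ℂ)` with respect to a base point `O ∈ ℍ³`:
the set of accumulation points in `Ĉ` of the orbit `Γ·O`. -/
def limitSet (Γ : Subgroup PSL2C) (O : H3) : Set (OnePoint ℂ) :=
  {ξ | iBd ξ ∈ closure (iH3 '' ((fun g => act3 g O) '' (Γ : Set PSL2C)))}

/-- The chordal (spherical) metric on the Riemann sphere `Ĉ = ℂ ∪ {∞}`. -/
def chordalDist : OnePoint ℂ → OnePoint ℂ → ℝ := fun x y =>
  Option.elim x
    (Option.elim y 0 (fun w => 2 / Real.sqrt (1 + ‖w‖ ^ 2)))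
    (fun z => Option.elim y (2 / Real.sqrt (1 + ‖z‖ ^ 2))
      (fun w => 2 * ‖z - w‖ /
        (Real.sqrt (1 + ‖z‖ ^ 2) * Real.sqrt (1 + ‖w‖ ^ 2))))

/-- A nontrivial element of `PSL(2,ℂ)` is parabolic if it has exactly one fixed point on `Ĉ`. -/
def IsParabolic (g : PSL2C) : Prop := g ≠ 1 ∧ ∃! ξ : OnePoint ℂ, actS g ξ = ξ

/-- A nontrivial element of `PSL(2,ℂ)` is loxodromic if it has exactly two fixed points
on `Ĉ` and generates an unbounded cyclic group. -/
def IsLoxodromic (g : PSL2C) : Prop :=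
  g ≠ 1 ∧ (∃ ξ η : OnePoint ℂ, ξ ≠ η ∧ {ζ | actS g ζ = ζ} = {ξ, η}) ∧
    ¬ IsCompact (closure (Set.range fun n : ℤ => g ^ n))

/-- A subgroup of `PSL(2,ℂ)` is discrete if each of its elements is isolated. -/
def IsDiscreteSubgroup (Γ : Subgroup PSL2C) : Prop :=
  ∀ g ∈ Γ, ∃ U : Set PSL2C, IsOpen U ∧ g ∈ U ∧ ∀ h ∈ Γ, h ∈ U → h = g

def IsTorsionFreeSubgroup (Γ : Subgroup PSL2C) : Prop :=
  ∀ g ∈ Γ, ∀ n : ℕ, 0 < n → g ^ n = 1 → g = 1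

/-- A Kleinian group: a discrete torsion-free subgroup of `PSL(2,ℂ)`. -/
def IsKleinian (Γ : Subgroup PSL2C) : Prop :=
  IsDiscreteSubgroup Γ ∧ IsTorsionFreeSubgroup Γ

/-- The Dirichlet fundamental polyhedron of `Γ` centered at `O`. -/
def DirichletDomain (Γ : Subgroup PSL2C) (O : H3) : Set H3 :=
  {x | ∀ g ∈ Γ, d3 x O ≤ d3 x (act3 g O)}

/-- A Kleinian group is geometrically finite if it has a finite-sided fundamental
polyhedron in `ℍ³` (concretely: some Dirichlet polyhedron has finitely many faces). -/
def IsGeometricallyFinite (Γ : Subgroup PSL2C) : Prop :=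
  ∃ O : H3, (∀ g ∈ Γ, g ≠ 1 → act3 g O ≠ O) ∧
    Set.Finite {g : PSL2C | g ∈ Γ ∧ g ≠ 1 ∧
      ∃ x ∈ DirichletDomain Γ O, d3 x O = d3 x (act3 g O)}

/-- The geodesic segment in `ℍ³` between two points, via the betweenness relation. -/
def geoSeg (X Y : H3) : Set H3 := {p | d3 X p + d3 p Y = d3 X Y}

/-- `f` is a Cannon–Thurston map for the isomorphism `ρ` of `Γ` onto its image:
a continuous map from `Λ_Γ` to `Λ_{ρ(Γ)}` satisfying `f(γ·ξ) = ρ(γ)·f(ξ)`. -/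
def IsCTMap (Γ : Subgroup PSL2C) (ρ : ↥Γ →* PSL2C) (O : H3)
    (f : OnePoint ℂ → OnePoint ℂ) : Prop :=
  ContinuousOn f (limitSet Γ O) ∧
  Set.MapsTo f (limitSet Γ O) (limitSet ρ.range O) ∧
  ∀ γ : ↥Γ, ∀ ξ ∈ limitSet Γ O, f (actS (↑γ) ξ) = actS (ρ γ) (f ξ)

/-- `ρ` is weakly type preserving: images of parabolic elements are parabolic. -/
def WeaklyTypePreserving (Γ : Subgroup PSL2C) (ρ : ↥Γ →* PSL2C) : Prop :=
  ∀ γ : ↥Γ, IsParabolic (↑γ) → IsParabolic (ρ γ)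

/-- `ρ` is strictly type preserving: `γ` is parabolic iff `ρ(γ)` is parabolic. -/
def StrictlyTypePreserving (Γ : Subgroup PSL2C) (ρ : ↥Γ →* PSL2C) : Prop :=
  ∀ γ : ↥Γ, IsParabolic (↑γ) ↔ IsParabolic (ρ γ)

/-- Algebraic convergence of a sequence of representations. -/
def ConvergesAlgebraically (Γ : Subgroup PSL2C) (ρ : ℕ → (↥Γ →* PSL2C))
    (ρlim : ↥Γ →* PSL2C) : Prop :=
  ∀ γ : ↥Γ, Filter.Tendsto (fun n => ρ n γ) Filter.atTop (𝓝 (ρlim γ))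

/-- Geometric (Chabauty) convergence of a sequence of subgroups of `PSL(2,ℂ)`:
every element of `H` is a limit of elements `gₙ ∈ Gₙ`, and every accumulation point of
any sequence `gₙ ∈ Gₙ` lies in `H`. -/
def ConvergesGeometrically (G : ℕ → Subgroup PSL2C) (H : Subgroup PSL2C) : Prop :=
  (∀ h ∈ H, ∃ g : ℕ → PSL2C, (∀ n, g n ∈ G n) ∧ Filter.Tendsto g Filter.atTop (𝓝 h)) ∧
  (∀ g : ℕ → PSL2C, (∀ n, g n ∈ G n) →
    ∀ x : PSL2C, MapClusterPt x Filter.atTop g → x ∈ H)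

/-- Strong convergence: algebraic convergence together with geometric convergence of the
image groups to the image of the limit representation. -/
def ConvergesStrongly (Γ : Subgroup PSL2C) (ρ : ℕ → (↥Γ →* PSL2C))
    (ρlim : ↥Γ →* PSL2C) : Prop :=
  ConvergesAlgebraically Γ ρ ρlim ∧
  ConvergesGeometrically (fun n => (ρ n).range) ρlim.range

/-- A subset of `ℍ³` is (hyperbolically) convex if it contains the geodesic segment
between any two of its points. -/
def IsHypConvex (S : Set H3) : Prop := ∀ X ∈ S, ∀ Y ∈ S, geoSeg X Y ⊆ S

/-- The convex hull in `ℍ³` of the limit set of `Γ`: the smallest closed convex subset of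
`ℍ³` whose closure in the compactification `ℍ³ ∪ Ĉ` contains `Λ_Γ`. -/
def convexHullOfLimitSet (Γ : Subgroup PSL2C) (O : H3) : Set H3 :=
  ⋂₀ {S : Set H3 | IsClosed S ∧ IsHypConvex S ∧ iBd '' limitSet Γ O ⊆ closure (iH3 '' S)}

/-- A Kleinian group is convex cocompact if the quotient of the convex hull of its limit
set by the group action is compact, i.e. the convex hull is covered by the group
translates of a compact set. -/
def IsConvexCocompact (Γ : Subgroup PSL2C) : Prop :=
  ∃ (O : H3) (C : Set H3), IsCompact C ∧
    convexHullOfLimitSet Γ O ⊆ ⋃ g ∈ (Γ : Set PSL2C), act3 g '' C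

namespace CannonThurston

open Filter ComplexConjugate
open scoped Matrix

/-! ### Hermitian forms: points of `ℍ³` and of `Ĉ` as positive semidefinite matrices -/

/-- Complex `2 × 2` matrices; `ℍ³` embeds as positive definite Hermitian matrices of
determinant one and `Ĉ` as rank one positive semidefinite ones, up to scale. -/
abbrev Mat2 := Matrix (Fin 2) (Fin 2) ℂ

/-- The Hermitian matrix of the point `(z, t)` of `ℂ × ℝ`, with lower right entry one. -/
def hermMat (z : ℂ) (t : ℝ) : Mat2 :=
  !![((Complex.normSq z + t ^ 2 : ℝ) : ℂ), z; conj z, 1]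

/-- The determinant one Hermitian matrix of a point of `ℍ³`. -/
def hypMat (p : H3) : Mat2 := (p.1.2)⁻¹ • hermMat p.1.1 p.1.2

/-- A rank one Hermitian matrix representing a point of the Riemann sphere. -/
def bdMat (ξ : OnePoint ℂ) : Mat2 :=
  Option.elim ξ !![1, 0; 0, 0] (fun z => hermMat z 0)

/-- The polarization of (twice) the determinant: the Lorentz form on Hermitian matrices. -/
def lorentz (H K : Mat2) : ℝ :=
  (H 0 0 * K 1 1 + H 1 1 * K 0 0 - H 0 1 * K 1 0 - H 1 0 * K 0 1).re

/-- The action of `SL(2,ℂ)` on Hermitian matrices. -/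
def actMat (A : SL2C) (H : Mat2) : Mat2 := A.1 * H * A.1ᴴ

lemma bdMat_infty : bdMat ∞ = !![1, 0; 0, 0] := rfl

lemma bdMat_coe (z : ℂ) : bdMat (z : OnePoint ℂ) = hermMat z 0 := rfl

lemma lorentz_comm (H K : Mat2) : lorentz H K = lorentz K H := by
  simp only [lorentz]; congr 1; ring

lemma lorentz_smul_left (r : ℝ) (H K : Mat2) : lorentz (r • H) K = r * lorentz H K := by
  simp only [lorentz, Matrix.smul_apply, Complex.real_smul, Complex.sub_re, Complex.add_re,
    Complex.mul_re, Complex.mul_im, Complex.ofReal_re, Complex.ofReal_im]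
  ring

lemma lorentz_smul_right (r : ℝ) (H K : Mat2) : lorentz H (r • K) = r * lorentz H K := by
  rw [lorentz_comm, lorentz_smul_left, lorentz_comm]

lemma lorentz_add_left (H H' K : Mat2) : lorentz (H + H') K = lorentz H K + lorentz H' K := by
  simp only [lorentz, Matrix.add_apply, ← Complex.add_re]
  congr 1; ring

lemma continuous_lorentz : Continuous fun P : Mat2 × Mat2 => lorentz P.1 P.2 := by
  unfold lorentz
  fun_prop

lemma tendsto_lorentz {ι : Type*} {l : Filter ι} {F G : ι → Mat2} {H K : Mat2}
    (hF : Tendsto F l (𝓝 H)) (hG : Tendsto G l (𝓝 K)) :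
    Tendsto (fun i => lorentz (F i) (G i)) l (𝓝 (lorentz H K)) :=
  Tendsto.comp (f := fun i => (F i, G i)) (continuous_lorentz.tendsto (H, K))
    (hF.prodMk_nhds hG)

lemma det_eq (A : SL2C) : A.1 0 0 * A.1 1 1 - A.1 0 1 * A.1 1 0 = 1 := by
  rw [← Matrix.det_fin_two]; exact A.2

lemma lorentz_actMat (A : SL2C) (H K : Mat2) :
    lorentz (actMat A H) (actMat A K) = lorentz H K := by
  have h := det_eq A
  have h' : conj (A.1 0 0) * conj (A.1 1 1) - conj (A.1 0 1) * conj (A.1 1 0) = 1 := by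
    simpa using congrArg conj h
  have key : lorentz (actMat A H) (actMat A K) =
      (((A.1 0 0 * A.1 1 1 - A.1 0 1 * A.1 1 0) *
        (conj (A.1 0 0) * conj (A.1 1 1) - conj (A.1 0 1) * conj (A.1 1 0))) *
        (H 0 0 * K 1 1 + H 1 1 * K 0 0 - H 0 1 * K 1 0 - H 1 0 * K 0 1)).re := by
    simp only [lorentz, actMat, Matrix.mul_apply, Fin.sum_univ_two, Matrix.conjTranspose_apply,
      RCLike.star_def]
    congr 1; ring
  rw [key, h, h', one_mul, one_mul, lorentz]

lemma actMat_smul (A : SL2C) (r : ℝ) (H : Mat2) : actMat A (r • H) = r • actMat A H := by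
  simp [actMat]

lemma actMat_mul (A A' : SL2C) (H : Mat2) : actMat (A * A') H = actMat A (actMat A' H) := by
  simp [actMat, Matrix.conjTranspose_mul, Matrix.mul_assoc]

lemma continuous_actMat (A : SL2C) : Continuous (actMat A) := by
  unfold actMat
  fun_prop

lemma actMat_center {A : SL2C} (hA : A ∈ Subgroup.center SL2C) (H : Mat2) : actMat A H = H := by
  obtain ⟨r, hr, h⟩ := Matrix.SpecialLinearGroup.mem_center_iff.1 hA
  have hr2 : Complex.normSq r = 1 := by
    have h1 : Complex.normSq r ^ 2 = 1 := by
      rw [← map_pow]; simpa using congrArg Complex.normSq hr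
    nlinarith [Complex.normSq_nonneg r]
  have h3 : r * conj r = 1 := by rw [Complex.mul_conj, hr2]; simp
  rw [actMat, ← h]
  ext i j
  fin_cases i <;> fin_cases j <;>
    simp [Matrix.mul_apply, Fin.sum_univ_two, Matrix.scalar_apply] <;>
    linear_combination (H _ _) * h3

lemma lorentz_hermMat (z w : ℂ) (t s : ℝ) :
    lorentz (hermMat z t) (hermMat w s) = Complex.normSq (z - w) + t ^ 2 + s ^ 2 := by
  simp [lorentz, hermMat, Complex.normSq_apply, -Complex.ofReal_pow]
  ring

lemma lorentz_infty_hermMat (w : ℂ) (s : ℝ) :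
    lorentz (bdMat ∞) (hermMat w s) = 1 := by
  simp [lorentz, hermMat, bdMat_infty]

lemma lorentz_infty_infty : lorentz (bdMat ∞) (bdMat ∞) = 0 := by
  simp [lorentz, bdMat_infty]

lemma lorentz_bdMat_nonneg (ξ η : OnePoint ℂ) : 0 ≤ lorentz (bdMat ξ) (bdMat η) := by
  induction ξ using OnePoint.rec <;> induction η using OnePoint.rec
  · rw [lorentz_infty_infty]
  · rw [bdMat_coe, lorentz_infty_hermMat]; norm_num
  · rw [bdMat_coe, lorentz_comm, lorentz_infty_hermMat]; norm_num
  · rw [bdMat_coe, bdMat_coe, lorentz_hermMat]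
    have := Complex.normSq_nonneg
    simp [this]

lemma lorentz_bdMat_eq_zero {ξ η : OnePoint ℂ} : lorentz (bdMat ξ) (bdMat η) = 0 ↔ ξ = η := by
  induction ξ using OnePoint.rec <;> induction η using OnePoint.rec
  · simp [lorentz_infty_infty]
  · simp [bdMat_coe, lorentz_infty_hermMat]
  · rw [bdMat_coe, lorentz_comm, lorentz_infty_hermMat]; simp
  · rw [bdMat_coe, bdMat_coe, lorentz_hermMat]
    simp [sub_eq_zero]

lemma lorentz_hypMat (p q : H3) : lorentz (hypMat p) (hypMat q) =
    (Complex.normSq (p.1.1 - q.1.1) + p.1.2 ^ 2 + q.1.2 ^ 2) / (p.1.2 * q.1.2) := by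
  have := p.2
  have := q.2
  rw [hypMat, hypMat, lorentz_smul_left, lorentz_smul_right, lorentz_hermMat]
  field_simp

lemma lorentz_hypMat_ge_two (p q : H3) : 2 ≤ lorentz (hypMat p) (hypMat q) := by
  have hp := p.2
  have hq := q.2
  rw [lorentz_hypMat, le_div_iff₀ (by positivity)]
  nlinarith [Complex.normSq_nonneg (p.1.1 - q.1.1), sq_nonneg (p.1.2 - q.1.2)]

lemma lorentz_hypMat_pos (p q : H3) : 0 < lorentz (hypMat p) (hypMat q) := by
  linarith [lorentz_hypMat_ge_two p q]

lemma lorentz_hypMat_self (p : H3) : lorentz (hypMat p) (hypMat p) = 2 := by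
  have := p.2
  rw [lorentz_hypMat]
  simp
  field_simp
  norm_num

lemma lorentz_bdMat_hypMat_pos (ξ : OnePoint ℂ) (p : H3) :
    0 < lorentz (bdMat ξ) (hypMat p) := by
  have hp := p.2
  rw [hypMat, lorentz_smul_right]
  induction ξ using OnePoint.rec
  · rw [lorentz_infty_hermMat]; positivity
  · rw [bdMat_coe, lorentz_hermMat]
    have := Complex.normSq_nonneg
    refine mul_pos (inv_pos.2 hp) ?_
    nlinarith [this (‹ℂ› - p.1.1), sq_pos_of_pos hp]

lemma hypMat_injective : Function.Injective hypMat := by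
  intro p q h
  have hp := p.2
  have hq := q.2
  have h1 := congrFun (congrFun h 1) 1
  have h0 := congrFun (congrFun h 0) 1
  simp only [hypMat, hermMat, Matrix.smul_apply, Complex.real_smul, Matrix.of_apply,
    Matrix.cons_val_one, Matrix.cons_val_zero, Matrix.cons_val_fin_one, mul_one,
    Complex.ofReal_inj, inv_inj] at h1 h0
  rw [h1] at h0
  have h2 := mul_left_cancel₀ (Complex.ofReal_ne_zero.2 (inv_ne_zero hq.ne')) h0
  exact Subtype.ext (Prod.ext h2 h1)

/-- The weak form `cosh d(x,y) ≤ 2 cosh d(x,p) cosh d(p,y)` of the triangle inequality. -/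
lemma lorentz_hypMat_le_mul (x p y : H3) : lorentz (hypMat x) (hypMat y) ≤
    lorentz (hypMat x) (hypMat p) * lorentz (hypMat p) (hypMat y) := by
  obtain ⟨⟨z, t⟩, ht⟩ := x
  obtain ⟨⟨v, r⟩, hr⟩ := p
  obtain ⟨⟨w, s⟩, hs⟩ := y
  simp only [lorentz_hypMat] at *
  rw [div_mul_div_comm, div_le_div_iff₀ (by positivity) (by positivity)]
  have h : ‖z - w‖ ≤ ‖z - v‖ + ‖v - w‖ := norm_sub_le_norm_sub_add_norm_sub z v w
  simp only [Complex.normSq_eq_norm_sq]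
  have ha := norm_nonneg (z - v)
  have hb := norm_nonneg (v - w)
  have hc := norm_nonneg (z - w)
  generalize ‖z - w‖ = c at *
  generalize ‖z - v‖ = a at *
  generalize ‖v - w‖ = b at *
  have h1 : c ^ 2 ≤ (a + b) ^ 2 := by gcongr
  have h2 : (c ^ 2 + t ^ 2 + s ^ 2) * r ^ 2 ≤ (a ^ 2 + t ^ 2 + r ^ 2) * (b ^ 2 + r ^ 2 + s ^ 2) := by
    have : c ^ 2 * r ^ 2 ≤ (a + b) ^ 2 * r ^ 2 := by gcongr
    have h5 : 0 ≤ a ^ 2 * s ^ 2 + t ^ 2 * b ^ 2 + t ^ 2 * s ^ 2 := by positivity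
    nlinarith [sq_nonneg (a * b - r ^ 2)]
  have h3 : 0 < t * s := by positivity
  nlinarith [mul_le_mul_of_nonneg_right h2 h3.le]

/-! ### The action on points -/

lemma hypMat_act3SL (A : SL2C) (p : H3) : hypMat (act3SL A p) = actMat A (hypMat p) := by
  have hd := denom_pos A p.1.1 p.1.2 p.2
  have hp := p.2
  obtain ⟨⟨z, t⟩, ht⟩ := p
  simp only at hd hp
  have hdet := det_eq A
  have hdet' : conj (A.1 0 0) * conj (A.1 1 1) - conj (A.1 0 1) * conj (A.1 1 0) = 1 := by
    simpa using congrArg conj hdet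
  set N : ℝ := Complex.normSq (A.1 1 0 * z + A.1 1 1) + Complex.normSq (A.1 1 0) * t ^ 2 with hN
  have hN' : (N : ℂ) = (A.1 1 0 * z + A.1 1 1) * (conj (A.1 1 0) * conj z + conj (A.1 1 1)) +
      A.1 1 0 * conj (A.1 1 0) * (t : ℂ) ^ 2 := by
    rw [hN]; push_cast; rw [← Complex.mul_conj, ← Complex.mul_conj]; simp
  have hNc : (N : ℂ) ≠ 0 := by exact_mod_cast hd.ne'
  have htc : (t : ℂ) ≠ 0 := by exact_mod_cast ht.ne'
  have h1 : hypMat (act3SL A ⟨(z, t), ht⟩) = ((t : ℂ) / N)⁻¹ • hermMat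
      (((A.1 0 0 * z + A.1 0 1) * conj (A.1 1 0 * z + A.1 1 1) +
        A.1 0 0 * conj (A.1 1 0) * (t : ℂ) ^ 2) / N) (t / N) := by
    ext i j
    simp only [hypMat, act3SL, Matrix.smul_apply, Complex.real_smul, smul_eq_mul]
    rw [← hN, Complex.ofReal_inv, Complex.ofReal_div]
  have h2 : hypMat (⟨(z, t), ht⟩ : H3) = (t : ℂ)⁻¹ • hermMat z t := by
    ext i j
    simp [hypMat]
  rw [h1, h2]
  ext i j
  fin_cases i <;> fin_cases j
  · simp only [hermMat, actMat, Complex.ofReal_add, ← Complex.mul_conj, Complex.ofReal_pow]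
    simp [Matrix.mul_apply, Fin.sum_univ_two]
    field_simp
    rw [hN']
    linear_combination
      (-(t : ℂ) ^ 2 * (conj (A.1 0 0) * conj (A.1 1 1) - conj (A.1 0 1) * conj (A.1 1 0))) * hdet -
        (t : ℂ) ^ 2 * hdet'
  · simp [Matrix.mul_apply, Fin.sum_univ_two, hermMat, actMat, ← Complex.mul_conj]
    field_simp
    ring
  · simp [Matrix.mul_apply, Fin.sum_univ_two, hermMat, actMat, ← Complex.mul_conj]
    field_simp
    ring
  · simp [Matrix.mul_apply, Fin.sum_univ_two, hermMat, actMat, ← Complex.mul_conj]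
    field_simp
    rw [hN']
    ring

lemma actMat_bdMat (A : SL2C) (ξ : OnePoint ℂ) :
    ∃ r : ℝ, 0 < r ∧ actMat A (bdMat ξ) = r • bdMat (mobiusSL A ξ) := by
  have hdet := det_eq A
  have eqn : ∀ z : ℂ, mobiusSL A z = if A.1 1 0 * z + A.1 1 1 = 0 then (∞ : OnePoint ℂ)
      else (((A.1 0 0 * z + A.1 0 1) / (A.1 1 0 * z + A.1 1 1) : ℂ) : OnePoint ℂ) := fun _ => rfl
  have eqi : mobiusSL A ∞ = if A.1 1 0 = 0 then (∞ : OnePoint ℂ)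
      else ((A.1 0 0 / A.1 1 0 : ℂ) : OnePoint ℂ) := rfl
  induction ξ using OnePoint.rec with
  | infty =>
    rw [eqi]
    split_ifs with h
    · refine ⟨Complex.normSq (A.1 0 0), Complex.normSq_pos.2 ?_, ?_⟩
      · rintro h0; simp [h, h0] at hdet
      · ext i j
        fin_cases i <;> fin_cases j <;>
        simp [Matrix.mul_apply, Fin.sum_univ_two, actMat, bdMat_infty, h, ← Complex.mul_conj]
    · refine ⟨Complex.normSq (A.1 1 0), Complex.normSq_pos.2 h, ?_⟩
      rw [bdMat_infty, bdMat_coe]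
      have h' : conj (A.1 1 0) ≠ 0 := by simpa using h
      ext i j
      fin_cases i <;> fin_cases j <;>
        simp [Matrix.mul_apply, Fin.sum_univ_two, actMat, hermMat, ← Complex.mul_conj] <;>
        field_simp
  | coe z =>
    rw [eqn]
    split_ifs with h
    · refine ⟨Complex.normSq (A.1 0 0 * z + A.1 0 1), Complex.normSq_pos.2 ?_, ?_⟩
      · intro h0
        have : (0 : ℂ) = 1 := by linear_combination hdet - A.1 0 0 * h + A.1 1 0 * h0
        norm_num at this
      · rw [bdMat_infty, bdMat_coe]
        have h' : conj (A.1 1 0) * conj z + conj (A.1 1 1) = 0 := by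
          simpa using congrArg conj h
        ext i j
        fin_cases i <;> fin_cases j <;>
          simp [Matrix.mul_apply, Fin.sum_univ_two, actMat, hermMat, ← Complex.mul_conj]
        · ring
        · linear_combination (A.1 0 0 * z + A.1 0 1) * h'
        · linear_combination (conj (A.1 0 0) * conj z + conj (A.1 0 1)) * h
        · linear_combination (conj (A.1 1 0) * conj z + conj (A.1 1 1)) * h
    · refine ⟨Complex.normSq (A.1 1 0 * z + A.1 1 1), Complex.normSq_pos.2 h, ?_⟩
      rw [bdMat_coe, bdMat_coe]
      generalize hw : (A.1 0 0 * z + A.1 0 1) / (A.1 1 0 * z + A.1 1 1) = w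
      rw [div_eq_iff h] at hw
      have hw' : conj (A.1 0 0) * conj z + conj (A.1 0 1) =
          conj w * (conj (A.1 1 0) * conj z + conj (A.1 1 1)) := by
        simpa using congrArg conj hw
      ext i j
      fin_cases i <;> fin_cases j <;>
        simp [Matrix.mul_apply, Fin.sum_univ_two, actMat, hermMat, ← Complex.mul_conj]
      · linear_combination (conj (A.1 0 0) * conj z + conj (A.1 0 1)) * hw +
          w * (A.1 1 0 * z + A.1 1 1) * hw'
      · linear_combination (conj (A.1 1 0) * conj z + conj (A.1 1 1)) * hw
      · linear_combination (A.1 1 0 * z + A.1 1 1) * hw'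
      · ring

/-! ### The action of `PSL(2,ℂ)` -/

/-- The action of `PSL(2,ℂ)` on Hermitian matrices. -/
def pactMat (q : PSL2C) (H : Mat2) : Mat2 := actMat q.out H

lemma pactMat_mk (A : SL2C) (H : Mat2) : pactMat (A : PSL2C) H = actMat A H := by
  obtain ⟨c, hc⟩ := QuotientGroup.mk_out_eq_mul (Subgroup.center SL2C) A
  rw [pactMat, hc, actMat_mul, actMat_center c.2]

lemma pactMat_mul (q r : PSL2C) (H : Mat2) : pactMat (q * r) H = pactMat q (pactMat r H) := by
  obtain ⟨A, rfl⟩ := QuotientGroup.mk_surjective q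
  obtain ⟨A', rfl⟩ := QuotientGroup.mk_surjective r
  rw [← QuotientGroup.mk_mul, pactMat_mk, pactMat_mk, pactMat_mk, actMat_mul]

lemma pactMat_one (H : Mat2) : pactMat 1 H = H := by
  rw [← QuotientGroup.mk_one, pactMat_mk, actMat_center (Subgroup.one_mem _)]

lemma pactMat_smul (q : PSL2C) (r : ℝ) (H : Mat2) : pactMat q (r • H) = r • pactMat q H :=
  actMat_smul _ _ _

lemma pactMat_add (q : PSL2C) (H K : Mat2) : pactMat q (H + K) = pactMat q H + pactMat q K := by
  simp only [pactMat, actMat, mul_add, add_mul]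

lemma continuous_pactMat (q : PSL2C) : Continuous (pactMat q) := continuous_actMat _

lemma lorentz_pactMat (q : PSL2C) (H K : Mat2) :
    lorentz (pactMat q H) (pactMat q K) = lorentz H K := lorentz_actMat _ _ _

lemma lorentz_pactMat_left (q : PSL2C) (H K : Mat2) :
    lorentz (pactMat q H) K = lorentz H (pactMat q⁻¹ K) := by
  rw [← lorentz_pactMat q⁻¹, ← pactMat_mul, inv_mul_cancel, pactMat_one]

lemma hypMat_act3 (q : PSL2C) (p : H3) : hypMat (act3 q p) = pactMat q (hypMat p) :=
  hypMat_act3SL _ _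

lemma pactMat_bdMat (q : PSL2C) (ξ : OnePoint ℂ) :
    ∃ r : ℝ, 0 < r ∧ pactMat q (bdMat ξ) = r • bdMat (actS q ξ) := actMat_bdMat _ _

lemma act3_mul (q r : PSL2C) (p : H3) : act3 (q * r) p = act3 q (act3 r p) := by
  apply hypMat_injective
  simp only [hypMat_act3, pactMat_mul]

lemma act3_one (p : H3) : act3 1 p = p := by
  apply hypMat_injective
  simp only [hypMat_act3, pactMat_one]

lemma act3_act3_inv (q : PSL2C) (p : H3) : act3 q (act3 q⁻¹ p) = p := by
  rw [← act3_mul, mul_inv_cancel, act3_one]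

lemma eq_of_bdMat_eq_smul {ξ η : OnePoint ℂ} {r s : ℝ} (hr : r ≠ 0)
    (h : r • bdMat ξ = s • bdMat η) : ξ = η := by
  rw [← lorentz_bdMat_eq_zero]
  have h1 : r * lorentz (bdMat ξ) (bdMat η) = 0 := by
    rw [← lorentz_smul_left, h, lorentz_smul_left, lorentz_bdMat_eq_zero.2 rfl, mul_zero]
  exact (mul_eq_zero.1 h1).resolve_left hr

lemma actS_mul (q r : PSL2C) (ξ : OnePoint ℂ) : actS (q * r) ξ = actS q (actS r ξ) := by
  obtain ⟨a, ha, h1⟩ := pactMat_bdMat (q * r) ξ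
  obtain ⟨b, hb, h2⟩ := pactMat_bdMat r ξ
  obtain ⟨c, hc, h3⟩ := pactMat_bdMat q (actS r ξ)
  rw [pactMat_mul, h2, pactMat_smul, h3, smul_smul] at h1
  exact eq_of_bdMat_eq_smul ha.ne' h1.symm

lemma actS_one (ξ : OnePoint ℂ) : actS 1 ξ = ξ := by
  obtain ⟨a, ha, h1⟩ := pactMat_bdMat 1 ξ
  rw [pactMat_one] at h1
  exact eq_of_bdMat_eq_smul ha.ne' (h1.symm.trans (one_smul ℝ _).symm)

lemma actS_inv_actS (q : PSL2C) (ξ : OnePoint ℂ) : actS q⁻¹ (actS q ξ) = ξ := by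
  rw [← actS_mul, inv_mul_cancel, actS_one]

lemma actS_injective (q : PSL2C) : Function.Injective (actS q) := fun ξ η h => by
  rw [← actS_inv_actS q ξ, h, actS_inv_actS]

/-! ### The compactification, normalized at a base point -/

/-- A continuous map from the one-point compactification of `ℂ × ℝ` to Hermitian matrices of
trace one. -/
def traceMat (x : OnePoint (ℂ × ℝ)) : Mat2 :=
  Option.elim x !![1, 0; 0, 0]
    (fun p => (Complex.normSq p.1 + p.2 ^ 2 + 1)⁻¹ • hermMat p.1 p.2)

lemma traceMat_coe (p : ℂ × ℝ) : traceMat (p : OnePoint (ℂ × ℝ)) =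
    (Complex.normSq p.1 + p.2 ^ 2 + 1)⁻¹ • hermMat p.1 p.2 := rfl

lemma traceDen_pos (p : ℂ × ℝ) : 0 < Complex.normSq p.1 + p.2 ^ 2 + 1 := by
  have := Complex.normSq_nonneg p.1
  positivity

lemma continuous_traceMat_coe : Continuous fun p : ℂ × ℝ => traceMat p := by
  simp only [traceMat_coe]
  have h : Continuous fun p : ℂ × ℝ => Complex.normSq p.1 + p.2 ^ 2 + 1 :=
    ((Complex.continuous_normSq.comp continuous_fst).add (continuous_snd.pow 2)).add
      continuous_const
  refine Continuous.smul (h.inv₀ fun p => (traceDen_pos p).ne') ?_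
  refine continuous_matrix fun i j => ?_
  have h2 : Continuous fun p : ℂ × ℝ => ((Complex.normSq p.1 + p.2 ^ 2 : ℝ) : ℂ) :=
    Complex.continuous_ofReal.comp
      ((Complex.continuous_normSq.comp continuous_fst).add (continuous_snd.pow 2))
  fin_cases i <;> fin_cases j
  · simpa [hermMat] using h2
  · simpa [hermMat] using continuous_fst
  · exact Complex.continuous_conj.comp continuous_fst
  · simpa [hermMat] using continuous_const

lemma tendsto_traceMat_cocompact :
    Tendsto (fun p : ℂ × ℝ => traceMat p) (cocompact (ℂ × ℝ)) (𝓝 (bdMat ∞)) := by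
  have hn := tendsto_norm_cocompact_atTop (E := ℂ × ℝ)
  have hle : ∀ p : ℂ × ℝ, ‖p‖ ^ 2 ≤ Complex.normSq p.1 + p.2 ^ 2 := by
    intro p
    rw [Complex.normSq_eq_norm_sq, show p.2 ^ 2 = ‖p.2‖ ^ 2 by rw [Real.norm_eq_abs, sq_abs],
      Prod.norm_def]
    rcases max_cases ‖p.1‖ ‖p.2‖ with ⟨h, _⟩ | ⟨h, _⟩ <;> rw [h]
    · nlinarith [sq_nonneg ‖p.2‖]
    · nlinarith [sq_nonneg ‖p.1‖]
  have hN : Tendsto (fun p : ℂ × ℝ => Complex.normSq p.1 + p.2 ^ 2 + 1) (cocompact _) atTop := by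
    refine tendsto_atTop_mono (fun p => ?_) hn
    nlinarith [hle p, sq_nonneg (‖p‖ - 1)]
  have hinv := tendsto_inv_atTop_zero.comp hN
  have hz : Tendsto (fun p : ℂ × ℝ => (Complex.normSq p.1 + p.2 ^ 2 + 1)⁻¹ * ‖p.1‖)
      (cocompact _) (𝓝 0) := by
    refine squeeze_zero' (Eventually.of_forall fun p => ?_) ?_ (tendsto_inv_atTop_zero.comp hn)
    · have := traceDen_pos p; positivity
    · filter_upwards [hn.eventually_gt_atTop 0] with p hp
      have h1 : ‖p.1‖ ≤ ‖p‖ := norm_fst_le p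
      simp only [Function.comp]
      rw [inv_mul_le_iff₀ (traceDen_pos p), ← div_eq_mul_inv, le_div_iff₀ hp]
      nlinarith [hle p]
  refine tendsto_pi_nhds.2 fun i => tendsto_pi_nhds.2 fun j => ?_
  fin_cases i <;> fin_cases j
  · have h1 : Tendsto (fun p : ℂ × ℝ => ((1 - (Complex.normSq p.1 + p.2 ^ 2 + 1)⁻¹ : ℝ) : ℂ))
        (cocompact _) (𝓝 1) := by
      have := (tendsto_const_nhds (x := (1 : ℝ))).sub hinv
      rw [sub_zero] at this
      exact_mod_cast (Complex.continuous_ofReal.tendsto _).comp this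
    refine h1.congr fun p => ?_
    have := traceDen_pos p
    simp only [traceMat_coe, hermMat, Matrix.smul_apply, Complex.real_smul]
    rw [show (1 - (Complex.normSq p.1 + p.2 ^ 2 + 1)⁻¹ : ℝ) =
      (Complex.normSq p.1 + p.2 ^ 2 + 1)⁻¹ * (Complex.normSq p.1 + p.2 ^ 2) by field_simp; ring]
    push_cast
    rfl
  · refine tendsto_zero_iff_norm_tendsto_zero.2 (hz.congr fun p => ?_)
    have := traceDen_pos p
    simp [traceMat_coe, hermMat, -Complex.ofReal_inv, -Complex.ofReal_add, abs_of_pos this]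
  · refine tendsto_zero_iff_norm_tendsto_zero.2 (hz.congr fun p => ?_)
    have := traceDen_pos p
    simp [traceMat_coe, hermMat, -Complex.ofReal_inv, -Complex.ofReal_add, abs_of_pos this]
  · have : Tendsto (fun p : ℂ × ℝ => (((Complex.normSq p.1 + p.2 ^ 2 + 1)⁻¹ : ℝ) : ℂ))
        (cocompact _) (𝓝 0) := by
      exact_mod_cast (Complex.continuous_ofReal.tendsto _).comp hinv
    refine this.congr fun p => ?_
    simp [traceMat_coe, hermMat]

lemma continuous_traceMat : Continuous traceMat := by
  rw [OnePoint.continuous_iff, coclosedCompact_eq_cocompact]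
  exact ⟨tendsto_traceMat_cocompact, continuous_traceMat_coe⟩

/-- Rescaling a Hermitian matrix so that its Lorentz product with the base point is one. -/
def normMat (O : H3) (H : Mat2) : Mat2 := (lorentz H (hypMat O))⁻¹ • H

lemma normMat_smul (O : H3) {r : ℝ} (hr : r ≠ 0) (H : Mat2) :
    normMat O (r • H) = normMat O H := by
  rw [normMat, lorentz_smul_left, smul_smul, normMat, mul_inv, mul_right_comm,
    inv_mul_cancel₀ hr, one_mul]

lemma tendsto_normMat (O : H3) {ι : Type*} {l : Filter ι} {F : ι → Mat2} {H : Mat2}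
    (hH : lorentz H (hypMat O) ≠ 0) (hF : Tendsto F l (𝓝 H)) :
    Tendsto (fun i => normMat O (F i)) l (𝓝 (normMat O H)) :=
  ((tendsto_lorentz hF tendsto_const_nhds).inv₀ hH).smul hF

/-- The embedding of `ℍ³` into normalized Hermitian matrices (the projective model). -/
def embH (O p : H3) : Mat2 := normMat O (hypMat p)

/-- The embedding of the Riemann sphere into normalized Hermitian matrices. -/
def embS (O : H3) (ξ : OnePoint ℂ) : Mat2 := normMat O (bdMat ξ)

/-- Twice the hyperbolic cosine of the distance to the base point. -/
def height (O p : H3) : ℝ := lorentz (hypMat p) (hypMat O)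

lemma height_pos (O p : H3) : 0 < height O p := lorentz_hypMat_pos p O

lemma height_ge_two (O p : H3) : 2 ≤ height O p := lorentz_hypMat_ge_two p O

/-- The common extension of `embH` and `embS` to the one-point compactification. -/
def embAll (O : H3) (x : OnePoint (ℂ × ℝ)) : Mat2 := normMat O (traceMat x)

lemma lorentz_traceMat_pos (O : H3) (x : OnePoint (ℂ × ℝ)) :
    0 < lorentz (traceMat x) (hypMat O) := by
  induction x using OnePoint.rec with
  | infty => exact lorentz_bdMat_hypMat_pos ∞ O
  | coe p =>
    have h1 := O.2
    have h2 := Complex.normSq_nonneg (p.1 - O.1.1)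
    rw [traceMat_coe, hypMat, lorentz_smul_left, lorentz_smul_right, lorentz_hermMat]
    have := traceDen_pos p
    positivity

lemma continuous_embAll (O : H3) : Continuous (embAll O) :=
  continuous_iff_continuousAt.2 fun x =>
    tendsto_normMat O (lorentz_traceMat_pos O x).ne' continuous_traceMat.continuousAt

lemma embAll_iH3 (O p : H3) : embAll O (iH3 p) = embH O p := by
  have hp := p.2
  have h : traceMat (iH3 p) =
      (p.1.2 * (Complex.normSq p.1.1 + p.1.2 ^ 2 + 1)⁻¹) • hypMat p := by
    rw [hypMat, smul_smul, iH3, traceMat_coe]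
    congr 1
    field_simp
  have := traceDen_pos p.1
  rw [embAll, h, normMat_smul, embH]
  positivity

lemma embAll_iBd (O : H3) (ξ : OnePoint ℂ) : embAll O (iBd ξ) = embS O ξ := by
  induction ξ using OnePoint.rec with
  | infty => rfl
  | coe z =>
    have h : traceMat (iBd z) = (Complex.normSq z + (0 : ℝ) ^ 2 + 1)⁻¹ • bdMat z := rfl
    rw [embAll, h, normMat_smul, embS]
    have := traceDen_pos (z, 0)
    positivity

lemma exists_iBd_of_lorentz_embAll_self {O : H3} {x : OnePoint (ℂ × ℝ)}
    (h : lorentz (embAll O x) (embAll O x) = 0) : ∃ ξ, x = iBd ξ := by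
  have h0 := lorentz_traceMat_pos O x
  rw [embAll, normMat, lorentz_smul_left, lorentz_smul_right] at h
  have h1 : lorentz (traceMat x) (traceMat x) = 0 := by
    have := h0.ne'
    simpa [this] using h
  induction x using OnePoint.rec with
  | infty => exact ⟨∞, rfl⟩
  | coe p =>
    have := (traceDen_pos p).ne'
    rw [traceMat_coe, lorentz_smul_left, lorentz_smul_right, lorentz_hermMat] at h1
    simp only [mul_eq_zero, inv_eq_zero, this, false_or, sub_self, map_zero, zero_add] at h1
    have h2 : p.2 = 0 := by nlinarith
    refine ⟨(p.1 : OnePoint ℂ), ?_⟩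
    show ((p : ℂ × ℝ) : OnePoint (ℂ × ℝ)) = (((p.1, (0 : ℝ)) : ℂ × ℝ) : OnePoint (ℂ × ℝ))
    rw [← h2]

lemma lorentz_embH (O p q : H3) : lorentz (embH O p) (embH O q) =
    lorentz (hypMat p) (hypMat q) / (height O p * height O q) := by
  rw [embH, embH, normMat, normMat, lorentz_smul_left, lorentz_smul_right, height, height]
  field_simp

lemma lorentz_embH_pos (O p q : H3) : 0 < lorentz (embH O p) (embH O q) := by
  rw [lorentz_embH]
  exact div_pos (lorentz_hypMat_pos p q) (mul_pos (height_pos O p) (height_pos O q))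

lemma lorentz_embS_eq_zero {O : H3} {ξ η : OnePoint ℂ} :
    lorentz (embS O ξ) (embS O η) = 0 ↔ ξ = η := by
  have h1 := (lorentz_bdMat_hypMat_pos ξ O).ne'
  have h2 := (lorentz_bdMat_hypMat_pos η O).ne'
  rw [embS, embS, normMat, normMat, lorentz_smul_left, lorentz_smul_right,
    ← lorentz_bdMat_eq_zero]
  simp [h1, h2]

lemma lorentz_embS_bdMat_eq_zero {O : H3} {ξ η : OnePoint ℂ} :
    lorentz (embS O ξ) (bdMat η) = 0 ↔ ξ = η := by
  have h1 := (lorentz_bdMat_hypMat_pos ξ O).ne'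
  rw [embS, normMat, lorentz_smul_left, ← lorentz_bdMat_eq_zero]
  simp [h1]

lemma lorentz_embS_bdMat_nonneg (O : H3) (ξ η : OnePoint ℂ) :
    0 ≤ lorentz (embS O ξ) (bdMat η) := by
  rw [embS, normMat, lorentz_smul_left]
  exact mul_nonneg (inv_nonneg.2 (lorentz_bdMat_hypMat_pos ξ O).le) (lorentz_bdMat_nonneg ξ η)

lemma embS_injective (O : H3) : Function.Injective (embS O) := fun ξ η h => by
  rw [← lorentz_embS_eq_zero (O := O), h, lorentz_embS_eq_zero]

lemma continuous_iBd : Continuous iBd := by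
  have h : Topology.IsClosedEmbedding fun z : ℂ => ((z, (0 : ℝ)) : ℂ × ℝ) :=
    (Isometry.of_dist_eq fun z w => by simp [Prod.dist_eq]).isClosedEmbedding
  have h1 : iBd = OnePoint.map fun z : ℂ => ((z, (0 : ℝ)) : ℂ × ℝ) := by
    funext ξ
    induction ξ using OnePoint.rec <;> rfl
  rw [h1]
  exact OnePoint.continuous_map h.continuous (by
    simpa only [coclosedCompact_eq_cocompact] using h.tendsto_cocompact)

lemma isClosedEmbedding_embS (O : H3) : Topology.IsClosedEmbedding (embS O) := by
  have : Continuous (embS O) := by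
    have := (continuous_embAll O).comp continuous_iBd
    simpa only [Function.comp_def, embAll_iBd] using this
  exact this.isClosedEmbedding (embS_injective O)

lemma iBd_mem_closure_iff (O : H3) {S : Set H3} {ξ : OnePoint ℂ} :
    iBd ξ ∈ closure (iH3 '' S) ↔ embS O ξ ∈ closure (embH O '' S) := by
  have h1 : embH O '' S = embAll O '' (iH3 '' S) := by
    rw [Set.image_image]; simp only [embAll_iH3]
  have hc := continuous_embAll O
  rw [h1, hc.isClosedMap.closure_image_eq_of_continuous hc, ← embAll_iBd]
  refine ⟨fun h => ⟨_, h, rfl⟩, ?_⟩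
  rintro ⟨x, hx, h⟩
  obtain ⟨η, rfl⟩ := exists_iBd_of_lorentz_embAll_self (O := O) (x := x) (by
    rw [h, embAll_iBd, lorentz_embS_eq_zero])
  rw [embAll_iBd, embAll_iBd] at h
  rwa [embS_injective O h] at hx

/-- A sequence of points leaving every ball converges, along an ultrafilter, to a point of the
sphere at infinity. -/
lemma exists_tendsto_embS {O : H3} {ι : Type*} (U : Ultrafilter ι) {p : ι → H3}
    (hp : Tendsto (fun i => height O (p i)) U atTop) :
    ∃ ξ, Tendsto (fun i => embH O (p i)) U (𝓝 (embS O ξ)) := by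
  obtain ⟨x, hx⟩ : ∃ x, Tendsto (fun i => iH3 (p i)) U (𝓝 x) :=
    ⟨(U.map fun i => iH3 (p i)).lim, Ultrafilter.le_nhds_lim _⟩
  have h1 : Tendsto (fun i => embH O (p i)) U (𝓝 (embAll O x)) := by
    simpa only [Function.comp_def, embAll_iH3] using
      ((continuous_embAll O).tendsto x).comp hx
  have h2 : Tendsto (fun i => lorentz (embH O (p i)) (embH O (p i))) U (𝓝 0) := by
    simp only [lorentz_embH, lorentz_hypMat_self]
    exact (hp.atTop_mul_atTop₀ hp).const_div_atTop 2
  obtain ⟨ξ, rfl⟩ := exists_iBd_of_lorentz_embAll_self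
    (tendsto_nhds_unique (tendsto_lorentz h1 h1) h2)
  exact ⟨ξ, by rwa [embAll_iBd] at h1⟩

lemma tendsto_height_of_lorentz_self {O : H3} {ι : Type*} {l : Filter ι} {p : ι → H3}
    (h1 : Tendsto (fun i => lorentz (embH O (p i)) (embH O (p i))) l (𝓝 0)) :
    Tendsto (fun i => height O (p i)) l atTop := by
  simp only [lorentz_embH, lorentz_hypMat_self] at h1
  have h2 : Tendsto (fun i => 2 / (height O (p i) * height O (p i))) l (𝓝[>] 0) :=
    tendsto_nhdsWithin_iff.2 ⟨h1, Eventually.of_forall fun i =>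
      div_pos two_pos (mul_pos (height_pos O _) (height_pos O _))⟩
  have h3 := h2.inv_tendsto_nhdsGT_zero
  refine tendsto_atTop.2 fun C => ?_
  filter_upwards [tendsto_atTop.1 h3 (C ^ 2)] with i hi
  have h4 := height_pos O (p i)
  simp only [Pi.inv_apply, inv_div] at hi
  nlinarith [sq_nonneg (C - height O (p i)), sq_nonneg (C + height O (p i))]

lemma tendsto_height_of_tendsto_embS {O : H3} {ι : Type*} {l : Filter ι} {p : ι → H3}
    {ξ : OnePoint ℂ} (h : Tendsto (fun i => embH O (p i)) l (𝓝 (embS O ξ))) :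
    Tendsto (fun i => height O (p i)) l atTop := by
  have h1 := tendsto_lorentz h h
  rw [lorentz_embS_eq_zero.2 rfl] at h1
  exact tendsto_height_of_lorentz_self h1

lemma embS_actS (O : H3) (q : PSL2C) (ξ : OnePoint ℂ) :
    normMat O (pactMat q (embS O ξ)) = embS O (actS q ξ) := by
  obtain ⟨r, hr, h⟩ := pactMat_bdMat q ξ
  have := lorentz_bdMat_hypMat_pos ξ O
  have h1 : embS O ξ = (lorentz (bdMat ξ) (hypMat O))⁻¹ • bdMat ξ := rfl
  rw [h1, pactMat_smul, h, normMat_smul O (inv_pos.2 this).ne', normMat_smul O hr.ne', embS]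

lemma embH_act3 (O : H3) (q : PSL2C) (p : H3) :
    normMat O (pactMat q (embH O p)) = embH O (act3 q p) := by
  have := lorentz_hypMat_pos p O
  have h1 : embH O p = (lorentz (hypMat p) (hypMat O))⁻¹ • hypMat p := rfl
  rw [h1, pactMat_smul, normMat_smul O (inv_pos.2 this).ne', ← hypMat_act3, embH]

lemma tendsto_embH_act3 {O : H3} (q : PSL2C) {ι : Type*} {l : Filter ι} {p : ι → H3}
    {ξ : OnePoint ℂ} (h : Tendsto (fun i => embH O (p i)) l (𝓝 (embS O ξ))) :
    Tendsto (fun i => embH O (act3 q (p i))) l (𝓝 (embS O (actS q ξ))) := by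
  have h1 := ((continuous_pactMat q).tendsto _).comp h
  have h2 := tendsto_normMat O (H := pactMat q (embS O ξ)) ?_ h1
  · simpa only [Function.comp_def, embS_actS, embH_act3] using h2
  · obtain ⟨r, hr, h3⟩ := pactMat_bdMat q ξ
    have h4 := lorentz_bdMat_hypMat_pos ξ O
    have h5 := lorentz_bdMat_hypMat_pos (actS q ξ) O
    rw [embS, normMat, pactMat_smul, h3, lorentz_smul_left, lorentz_smul_left]
    positivity

/-! ### Distance and geodesic segments -/

lemma cosh_d3 (p q : H3) : Real.cosh (d3 p q) = lorentz (hypMat p) (hypMat q) / 2 := by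
  have hp := p.2
  have hq := q.2
  have h1 : 1 + (‖p.1.1 - q.1.1‖ ^ 2 + (p.1.2 - q.1.2) ^ 2) / (2 * p.1.2 * q.1.2) =
      lorentz (hypMat p) (hypMat q) / 2 := by
    rw [lorentz_hypMat, Complex.normSq_eq_norm_sq]
    field_simp
    ring
  rw [d3, h1, arcosh]
  exact Real.cosh_arcosh (by linarith [lorentz_hypMat_ge_two p q])

lemma d3_nonneg (p q : H3) : 0 ≤ d3 p q := by
  rw [d3, arcosh]
  refine Real.log_nonneg ?_
  have hp := p.2
  have hq := q.2
  have h1 : 0 ≤ (‖p.1.1 - q.1.1‖ ^ 2 + (p.1.2 - q.1.2) ^ 2) / (2 * p.1.2 * q.1.2) := by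
    positivity
  linarith [Real.sqrt_nonneg ((1 + (‖p.1.1 - q.1.1‖ ^ 2 + (p.1.2 - q.1.2) ^ 2) /
    (2 * p.1.2 * q.1.2)) ^ 2 - 1)]

lemma cosh_d3_base (O p : H3) : Real.cosh (d3 O p) = height O p / 2 := by
  rw [cosh_d3, lorentz_comm, height]

lemma eq_of_cosh_eq {a b : ℝ} (ha : 0 ≤ a) (hb : 0 ≤ b) (h : Real.cosh a = Real.cosh b) :
    a = b := Real.cosh_strictMonoOn.injOn ha hb h

lemma d3_eq_of_lorentz_eq {p q p' q' : H3}
    (h : lorentz (hypMat p) (hypMat q) = lorentz (hypMat p') (hypMat q')) :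
    d3 p q = d3 p' q' :=
  eq_of_cosh_eq (d3_nonneg _ _) (d3_nonneg _ _) (by rw [cosh_d3, cosh_d3, h])

lemma d3_act3 (q : PSL2C) (x y : H3) : d3 (act3 q x) (act3 q y) = d3 x y :=
  d3_eq_of_lorentz_eq (by rw [hypMat_act3, hypMat_act3, lorentz_pactMat])

lemma d3_self (x : H3) : d3 x x = 0 :=
  eq_of_cosh_eq (d3_nonneg _ _) le_rfl (by rw [cosh_d3, lorentz_hypMat_self]; norm_num)

lemma left_mem_geoSeg (X Y : H3) : X ∈ geoSeg X Y := by
  rw [geoSeg, Set.mem_ofPred_eq, d3_self, zero_add]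

lemma right_mem_geoSeg (X Y : H3) : Y ∈ geoSeg X Y := by
  rw [geoSeg, Set.mem_ofPred_eq, d3_self, add_zero]

lemma act3_mem_geoSeg (q : PSL2C) {X Y p : H3} (h : p ∈ geoSeg X Y) :
    act3 q p ∈ geoSeg (act3 q X) (act3 q Y) := by
  rw [geoSeg, Set.mem_ofPred_eq] at *
  rwa [d3_act3, d3_act3, d3_act3]

/-- A geodesic segment passing close to the base point has endpoints far apart in the
projective model. -/
lemma le_lorentz_embH_of_mem_geoSeg {O X Y p : H3} (h : p ∈ geoSeg X Y) :
    (2 * height O p ^ 2)⁻¹ ≤ lorentz (embH O X) (embH O Y) := by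
  have h1 : lorentz (hypMat X) (hypMat p) * lorentz (hypMat p) (hypMat Y) ≤
      2 * lorentz (hypMat X) (hypMat Y) := by
    have h2 : d3 X p + d3 p Y = d3 X Y := h
    have h3 := Real.cosh_add (d3 X p) (d3 p Y)
    have h4 := mul_nonneg (Real.sinh_nonneg_iff.2 (d3_nonneg X p))
      (Real.sinh_nonneg_iff.2 (d3_nonneg p Y))
    rw [h2, cosh_d3, cosh_d3, cosh_d3] at h3
    linarith
  have h5 : height O X ≤ lorentz (hypMat X) (hypMat p) * height O p :=
    lorentz_hypMat_le_mul X p O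
  have h6 : height O Y ≤ lorentz (hypMat p) (hypMat Y) * height O p := by
    rw [lorentz_comm (hypMat p)]
    exact lorentz_hypMat_le_mul Y p O
  have hX := height_pos O X
  have hY := height_pos O Y
  have hp := height_pos O p
  have hXp := lorentz_hypMat_pos X p
  rw [lorentz_embH, inv_le_iff_one_le_mul₀ (by positivity), div_mul_eq_mul_div,
    one_le_div (by positivity)]
  calc height O X * height O Y ≤ (lorentz (hypMat X) (hypMat p) * height O p) *
        (lorentz (hypMat p) (hypMat Y) * height O p) := by gcongr
    _ = (lorentz (hypMat X) (hypMat p) * lorentz (hypMat p) (hypMat Y)) * height O p ^ 2 := by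
      ring
    _ ≤ (2 * lorentz (hypMat X) (hypMat Y)) * height O p ^ 2 := by gcongr
    _ = _ := by ring

/-- A positive combination of two points of the hyperboloid, if on the hyperboloid, is a point
of `ℍ³`. -/
lemma exists_hypMat_eq_add {X Y : H3} {α β : ℝ} (hα : 0 < α) (hβ : 0 < β)
    (h : α ^ 2 + β ^ 2 + α * β * lorentz (hypMat X) (hypMat Y) = 1) :
    ∃ p : H3, hypMat p = α • hypMat X + β • hypMat Y := by
  obtain ⟨⟨z, t⟩, ht⟩ := X
  obtain ⟨⟨w, s⟩, hs⟩ := Y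
  rw [lorentz_hypMat] at h
  simp only at h ht hs
  obtain ⟨a, rfl⟩ : ∃ a, α = a * t := ⟨α / t, by field_simp⟩
  obtain ⟨b, rfl⟩ : ∃ b, β = b * s := ⟨β / s, by field_simp⟩
  have ha : 0 < a := pos_of_mul_pos_left hα ht.le
  have hb : 0 < b := pos_of_mul_pos_left hβ hs.le
  have hk : 0 < a + b := by positivity
  have hk' : ((a : ℂ) + b) ≠ 0 := by exact_mod_cast hk.ne'
  have ht' : (t : ℂ) ≠ 0 := by exact_mod_cast ht.ne'
  have hs' : (s : ℂ) ≠ 0 := by exact_mod_cast hs.ne'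
  refine ⟨⟨(((a + b)⁻¹ : ℝ) * ((a : ℂ) * z + (b : ℂ) * w), (a + b)⁻¹), inv_pos.2 hk⟩, ?_⟩
  ext i j
  fin_cases i <;> fin_cases j
  · have h1 : (a + b) * (Complex.normSq (((a + b)⁻¹ : ℝ) * ((a : ℂ) * z + (b : ℂ) * w)) +
        ((a + b)⁻¹) ^ 2) = a * t * (t⁻¹ * (Complex.normSq z + t ^ 2)) +
        b * s * (s⁻¹ * (Complex.normSq w + s ^ 2)) := by
      simp only [Complex.normSq_apply, Complex.mul_re, Complex.mul_im, Complex.add_re,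
        Complex.add_im, Complex.ofReal_re, Complex.ofReal_im, Complex.sub_re,
        Complex.sub_im] at h ⊢
      field_simp at h ⊢
      linear_combination -h
    simp only [hypMat, hermMat, Matrix.smul_apply, Matrix.add_apply, Complex.real_smul, inv_inv]
    show ((a + b : ℝ) : ℂ) * ((Complex.normSq (((a + b)⁻¹ : ℝ) * ((a : ℂ) * z + (b : ℂ) * w)) +
        ((a + b)⁻¹) ^ 2 : ℝ) : ℂ) =
      ((a * t : ℝ) : ℂ) * (((t⁻¹ : ℝ) : ℂ) * ((Complex.normSq z + t ^ 2 : ℝ) : ℂ)) +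
        ((b * s : ℝ) : ℂ) * (((s⁻¹ : ℝ) : ℂ) * ((Complex.normSq w + s ^ 2 : ℝ) : ℂ))
    exact_mod_cast h1
  · simp [hypMat, hermMat]
    field_simp
  · simp [hypMat, hermMat]
    field_simp
  · simp [hypMat, hermMat]
    field_simp

/-- The geodesic segment between two points that are far apart in the projective model passes
close to the base point. -/
lemma exists_mem_geoSeg_height_le (O X Y : H3) :
    ∃ p ∈ geoSeg X Y, height O p ^ 2 * lorentz (embH O X) (embH O Y) ≤ 4 := by
  have hX := height_pos O X
  have hY := height_pos O Y
  have hL := lorentz_hypMat_ge_two X Y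
  set L := lorentz (hypMat X) (hypMat Y) with hLdef
  set u := (height O X)⁻¹ with hu
  set v := (height O Y)⁻¹ with hv
  have hu0 : 0 < u := inv_pos.2 hX
  have hv0 : 0 < v := inv_pos.2 hY
  have hQ : 0 < u ^ 2 + v ^ 2 + u * v * L := by positivity
  set k := (Real.sqrt (u ^ 2 + v ^ 2 + u * v * L))⁻¹ with hk
  have hk0 : 0 < k := by positivity
  have hk2 : k ^ 2 * (u ^ 2 + v ^ 2 + u * v * L) = 1 := by
    rw [hk, inv_pow, Real.sq_sqrt hQ.le, inv_mul_cancel₀ hQ.ne']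
  have hα : 0 < k * u := by positivity
  have hβ : 0 < k * v := by positivity
  have hn : (k * u) ^ 2 + (k * v) ^ 2 + (k * u) * (k * v) * L = 1 := by linear_combination hk2
  obtain ⟨p, hp⟩ := exists_hypMat_eq_add hα hβ hn
  have hO : height O p = 2 * k := by
    have h1 : lorentz (hypMat X) (hypMat O) = height O X := rfl
    have h2 : lorentz (hypMat Y) (hypMat O) = height O Y := rfl
    rw [height, hp, lorentz_add_left, lorentz_smul_left, lorentz_smul_left, h1, h2, hu, hv]
    field_simp
    norm_num
  refine ⟨p, ?_, ?_⟩
  · have hXp : lorentz (hypMat X) (hypMat p) = 2 * (k * u) + k * v * L := by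
      rw [lorentz_comm, hp, lorentz_add_left, lorentz_smul_left, lorentz_smul_left,
        lorentz_hypMat_self, lorentz_comm (hypMat Y)]
      ring
    have hpY : lorentz (hypMat p) (hypMat Y) = k * u * L + 2 * (k * v) := by
      rw [hp, lorentz_add_left, lorentz_smul_left, lorentz_smul_left, lorentz_hypMat_self]
      ring
    have hS := Real.cosh_sq (d3 X Y)
    have hS0 := Real.sinh_nonneg_iff.2 (d3_nonneg X Y)
    have h1 := cosh_d3 X p
    have h2 := cosh_d3 p Y
    have h3 := cosh_d3 X Y
    rw [hXp] at h1
    rw [hpY] at h2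
    have h4 : Real.sinh (d3 X p) = k * v * Real.sinh (d3 X Y) := by
      have := Real.cosh_sq (d3 X p)
      refine (sq_eq_sq₀ (Real.sinh_nonneg_iff.2 (d3_nonneg X p)) (by positivity)).1 ?_
      rw [h1] at this
      rw [h3] at hS
      linear_combination (k * v) ^ 2 * hS - this + hn
    have h5 : Real.sinh (d3 p Y) = k * u * Real.sinh (d3 X Y) := by
      have := Real.cosh_sq (d3 p Y)
      refine (sq_eq_sq₀ (Real.sinh_nonneg_iff.2 (d3_nonneg p Y)) (by positivity)).1 ?_
      rw [h2] at this
      rw [h3] at hS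
      linear_combination (k * u) ^ 2 * hS - this + hn
    refine eq_of_cosh_eq (add_nonneg (d3_nonneg _ _) (d3_nonneg _ _)) (d3_nonneg _ _) ?_
    rw [Real.cosh_add, h1, h2, h3, h4, h5]
    rw [h3] at hS
    linear_combination -(k * v) * (k * u) * hS + L / 2 * hn
  · have h1 : lorentz (embH O X) (embH O Y) = u * v * L := by
      rw [lorentz_embH, hu, hv, ← hLdef]
      field_simp
    rw [hO, h1]
    have := mul_pos hk0 hk0
    nlinarith [mul_pos this (pow_pos hu0 2), mul_pos this (pow_pos hv0 2)]

/-! ### Limit sets and their convex hulls -/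

lemma continuous_act3 (q : PSL2C) : Continuous (act3 q) := by
  have h1 : Continuous fun p : H3 => Complex.normSq (q.out.1 1 0 * p.1.1 + q.out.1 1 1) +
      Complex.normSq (q.out.1 1 0) * p.1.2 ^ 2 := by
    have := Complex.continuous_normSq
    fun_prop
  refine Continuous.subtype_mk (Continuous.prodMk (Continuous.div ?_ ?_ ?_)
    (Continuous.div ?_ h1 ?_)) _
  · have h2 := Complex.continuous_conj
    have h3 := Complex.continuous_ofReal
    fun_prop
  · exact Complex.continuous_ofReal.comp h1
  · exact fun p => Complex.ofReal_ne_zero.2 (denom_pos _ _ _ p.2).ne'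
  · fun_prop
  · exact fun p => (denom_pos _ _ _ p.2).ne'

lemma comap_nhds_neBot_of_mem_closure_range {ι X : Type*} [TopologicalSpace X] {s : ι → X} {x : X}
    (h : x ∈ closure (Set.range s)) : (comap s (𝓝 x)).NeBot := by
  refine comap_neBot_iff.2 fun t ht => ?_
  obtain ⟨_, h1, i, rfl⟩ := mem_closure_iff_nhds.1 h t ht
  exact ⟨i, h1⟩

lemma embS_actS_mem_closure {O : H3} {S : Set H3} {ξ : OnePoint ℂ} (q : PSL2C)
    (h : embS O ξ ∈ closure (embH O '' S)) :
    embS O (actS q ξ) ∈ closure (embH O '' (act3 q '' S)) := by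
  rw [Set.image_eq_range] at h
  have := comap_nhds_neBot_of_mem_closure_range h
  exact mem_closure_of_tendsto (tendsto_embH_act3 q
    (tendsto_comap (f := fun p : S => embH O p))) (Eventually.of_forall fun p =>
      ⟨_, ⟨p.1, p.2, rfl⟩, rfl⟩)

lemma mem_limitSet_iff {Γ : Subgroup PSL2C} {O : H3} {ξ : OnePoint ℂ} :
    ξ ∈ limitSet Γ O ↔ embS O ξ ∈ closure (Set.range fun γ : Γ => embH O (act3 γ O)) := by
  rw [limitSet, Set.mem_ofPred_eq, iBd_mem_closure_iff O, Set.image_image, Set.image_eq_range]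
  rfl

lemma mem_limitSet_of_tendsto {Γ : Subgroup PSL2C} {O : H3} {ξ : OnePoint ℂ} {ι : Type*}
    {l : Filter ι} [l.NeBot] {γ : ι → PSL2C} (hγ : ∀ i, γ i ∈ Γ)
    (h : Tendsto (fun i => embH O (act3 (γ i) O)) l (𝓝 (embS O ξ))) : ξ ∈ limitSet Γ O :=
  mem_limitSet_iff.2 (mem_closure_of_tendsto h (Eventually.of_forall fun i => ⟨⟨γ i, hγ i⟩, rfl⟩))

lemma actS_mem_limitSet {Γ : Subgroup PSL2C} {O : H3} {ξ : OnePoint ℂ} {q : PSL2C} (hq : q ∈ Γ)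
    (h : ξ ∈ limitSet Γ O) : actS q ξ ∈ limitSet Γ O := by
  rw [limitSet, Set.mem_ofPred_eq, iBd_mem_closure_iff O] at *
  refine closure_mono (Set.image_mono ?_) (embS_actS_mem_closure q h)
  rintro _ ⟨_, ⟨g, hg, rfl⟩, rfl⟩
  exact ⟨q * g, Γ.mul_mem hq hg, act3_mul _ _ _⟩

lemma act3_mem_convexHullOfLimitSet {Γ : Subgroup PSL2C} {O x : H3} {q : PSL2C} (hq : q ∈ Γ)
    (hx : x ∈ convexHullOfLimitSet Γ O) : act3 q x ∈ convexHullOfLimitSet Γ O := by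
  rintro S ⟨hS1, hS2, hS3⟩
  refine hx (act3 q ⁻¹' S) ⟨hS1.preimage (continuous_act3 q), ?_, ?_⟩
  · intro X hX Y hY p hp
    exact hS2 _ hX _ hY (act3_mem_geoSeg q hp)
  · rintro _ ⟨ξ, hξ, rfl⟩
    have h1 := hS3 ⟨_, actS_mem_limitSet hq hξ, rfl⟩
    rw [iBd_mem_closure_iff O] at h1 ⊢
    have h2 := embS_actS_mem_closure q⁻¹ h1
    rw [actS_inv_actS] at h2
    refine closure_mono (Set.image_mono ?_) h2
    rintro _ ⟨p, hp, rfl⟩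
    rwa [Set.mem_preimage, act3_act3_inv]

lemma isHypConvex_convexHullOfLimitSet (Γ : Subgroup PSL2C) (O : H3) :
    IsHypConvex (convexHullOfLimitSet Γ O) :=
  fun _ hX _ hY _ hp S hS => hS.2.1 _ (hX S hS) _ (hY S hS) hp

lemma geoSeg_subset_convexHullOfLimitSet {Γ : Subgroup PSL2C} {O : H3}
    (hO : O ∈ convexHullOfLimitSet Γ O) (γ γ' : Γ) :
    geoSeg (act3 γ O) (act3 γ' O) ⊆ convexHullOfLimitSet Γ O :=
  isHypConvex_convexHullOfLimitSet Γ O _ (act3_mem_convexHullOfLimitSet γ.2 hO) _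
    (act3_mem_convexHullOfLimitSet γ'.2 hO)

lemma limitSet_nonempty {Γ : Subgroup PSL2C} {O : H3} (hO : O ∈ convexHullOfLimitSet Γ O) :
    (limitSet Γ O).Nonempty := by
  by_contra h
  rw [Set.not_nonempty_iff_eq_empty] at h
  exact hO ∅ ⟨isClosed_empty, fun _ hX => hX.elim, by simp [h]⟩

/-! ### From the geodesic criterion to the Cannon–Thurston map -/

lemma lorentz_embH_le_of_le_d3 {O X Y : H3} {R : ℝ} (hR : 0 ≤ R)
    (h : ∀ p ∈ geoSeg X Y, R ≤ d3 O p) :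
    lorentz (embH O X) (embH O Y) ≤ (1 + R ^ 2)⁻¹ := by
  obtain ⟨p, hp, h1⟩ := exists_mem_geoSeg_height_le O X Y
  have h2 := h p hp
  have h3 := cosh_d3_base O p
  have h4 := Real.cosh_sq (d3 O p)
  have h5 := Real.self_le_sinh_iff.2 (hR.trans h2)
  have h6 := lorentz_embH_pos O X Y
  have h7 : 1 + R ^ 2 ≤ (height O p / 2) ^ 2 := by
    rw [← h3, h4]
    nlinarith
  rw [le_inv_comm₀ h6 (by positivity), ← one_div, le_div_iff₀ h6]
  nlinarith

lemma le_d3_of_lorentz_embH_lt {O X Y : H3} {R : ℝ}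
    (h : lorentz (embH O X) (embH O Y) < (8 * Real.cosh R ^ 2)⁻¹) :
    ∀ p ∈ geoSeg X Y, R ≤ d3 O p := by
  intro p hp
  by_contra! h1
  have h2 := le_lorentz_embH_of_mem_geoSeg (O := O) hp
  have h3 : Real.cosh (d3 O p) ≤ Real.cosh R := by
    rw [Real.cosh_le_cosh, abs_of_nonneg (d3_nonneg _ _)]
    exact h1.le.trans (le_abs_self _)
  rw [cosh_d3_base] at h3
  have h4 := height_pos O p
  refine absurd (h2.trans_lt h) (not_lt.2 (inv_anti₀ (by positivity) ?_))
  nlinarith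

section Criterion

variable {Γ : Subgroup PSL2C} {O : H3} {ρ : Γ →* PSL2C} {F : ℕ → ℕ}

lemma tendsto_lorentz_image (hF : Tendsto F atTop atTop)
    (H : ∀ M : ℕ, ∀ γ γ' : Γ,
      (∀ p ∈ geoSeg (act3 γ O) (act3 γ' O), (M : ℝ) ≤ d3 O p) →
      ∀ p ∈ geoSeg (act3 (ρ γ) O) (act3 (ρ γ') O), (F M : ℝ) ≤ d3 O p)
    {ι : Type*} {l : Filter ι} {γ γ' : ι → Γ}
    (h : Tendsto (fun i => lorentz (embH O (act3 (γ i) O)) (embH O (act3 (γ' i) O))) l (𝓝 0)) :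
    Tendsto (fun i => lorentz (embH O (act3 (ρ (γ i)) O)) (embH O (act3 (ρ (γ' i)) O))) l
      (𝓝 0) := by
  refine tendsto_order.2 ⟨fun ε hε => Eventually.of_forall fun i =>
    hε.trans (lorentz_embH_pos _ _ _), fun ε hε => ?_⟩
  have h1 : Tendsto (fun M => (1 + (F M : ℝ) ^ 2)⁻¹) atTop (𝓝 0) := by
    refine tendsto_inv_atTop_zero.comp (tendsto_atTop_add_const_left _ _ ?_)
    exact (tendsto_pow_atTop two_ne_zero).comp (tendsto_natCast_atTop_atTop.comp hF)
  obtain ⟨M, hM⟩ := (h1.eventually (gt_mem_nhds hε)).exists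
  filter_upwards [h.eventually (gt_mem_nhds
    (show 0 < (8 * Real.cosh M ^ 2)⁻¹ by have := Real.cosh_pos M; positivity))] with i hi
  exact (lorentz_embH_le_of_le_d3 (Nat.cast_nonneg _)
    (H M _ _ (le_d3_of_lorentz_embH_lt hi))).trans_lt hM

lemma exists_tendsto_image (hF : Tendsto F atTop atTop)
    (H : ∀ M : ℕ, ∀ γ γ' : Γ,
      (∀ p ∈ geoSeg (act3 γ O) (act3 γ' O), (M : ℝ) ≤ d3 O p) →
      ∀ p ∈ geoSeg (act3 (ρ γ) O) (act3 (ρ γ') O), (F M : ℝ) ≤ d3 O p)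
    {ξ : OnePoint ℂ} (hξ : ξ ∈ limitSet Γ O) :
    ∃ a, Tendsto (fun γ : Γ => embH O (act3 (ρ γ) O))
      (comap (fun γ : Γ => embH O (act3 γ O)) (𝓝 (embS O ξ))) (𝓝 (embS O a)) := by
  have := comap_nhds_neBot_of_mem_closure_range (mem_limitSet_iff.1 hξ)
  have hs := tendsto_comap (f := fun γ : Γ => embH O (act3 γ O)) (x := 𝓝 (embS O ξ))
  set l := comap (fun γ : Γ => embH O (act3 γ O)) (𝓝 (embS O ξ)) with hl
  have key : ∀ {ι : Type} {l' : Filter ι} {γ γ' : ι → Γ}, Tendsto γ l' l → Tendsto γ' l' l →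
      Tendsto (fun i => lorentz (embH O (act3 (ρ (γ i)) O)) (embH O (act3 (ρ (γ' i)) O))) l'
        (𝓝 0) := by
    intro ι l' γ γ' h1 h2
    refine tendsto_lorentz_image hF H ?_
    have := tendsto_lorentz (hs.comp h1) (hs.comp h2)
    rwa [lorentz_embS_eq_zero.2 rfl] at this
  have hV : ∀ V : Ultrafilter Γ, (V : Filter Γ) ≤ l →
      ∃ a, Tendsto (fun γ : Γ => embH O (act3 (ρ γ) O)) V (𝓝 (embS O a)) := fun V hV =>
    exists_tendsto_embS V (tendsto_height_of_lorentz_self (key hV hV))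
  obtain ⟨a, ha⟩ := hV (Ultrafilter.of l) (Ultrafilter.of_le l)
  refine ⟨a, (tendsto_iff_ultrafilter _ _ _).2 fun V hVl => ?_⟩
  obtain ⟨b, hb⟩ := hV V hVl
  have h1 := key ((Tendsto.mono_left tendsto_fst (le_refl
      ((Ultrafilter.of l : Filter Γ) ×ˢ (V : Filter Γ)))).mono_right (Ultrafilter.of_le l))
    ((Tendsto.mono_left tendsto_snd (le_refl
      ((Ultrafilter.of l : Filter Γ) ×ˢ (V : Filter Γ)))).mono_right hVl)
  have h2 := tendsto_lorentz (ha.comp (tendsto_fst (f := (Ultrafilter.of l : Filter Γ))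
    (g := (V : Filter Γ)))) (hb.comp tendsto_snd)
  rwa [lorentz_embS_eq_zero.1 (tendsto_nhds_unique h2 h1)]

theorem exists_isCTMap (hF : Tendsto F atTop atTop)
    (H : ∀ M : ℕ, ∀ γ γ' : Γ,
      (∀ p ∈ geoSeg (act3 γ O) (act3 γ' O), (M : ℝ) ≤ d3 O p) →
      ∀ p ∈ geoSeg (act3 (ρ γ) O) (act3 (ρ γ') O), (F M : ℝ) ≤ d3 O p) :
    ∃ f, IsCTMap Γ ρ O f := by
  classical
  have hex : ∀ ξ, ∃ a, ξ ∈ limitSet Γ O → Tendsto (fun γ : Γ => embH O (act3 (ρ γ) O))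
      (comap (fun γ : Γ => embH O (act3 γ O)) (𝓝 (embS O ξ))) (𝓝 (embS O a)) := fun ξ => by
    by_cases hξ : ξ ∈ limitSet Γ O
    · obtain ⟨a, ha⟩ := exists_tendsto_image hF H hξ
      exact ⟨a, fun _ => ha⟩
    · exact ⟨ξ, fun h => (hξ h).elim⟩
  choose f hf using hex
  have hne : ∀ ξ ∈ limitSet Γ O,
      (comap (fun γ : Γ => embH O (act3 γ O)) (𝓝 (embS O ξ))).NeBot := fun ξ hξ =>
    comap_nhds_neBot_of_mem_closure_range (mem_limitSet_iff.1 hξ)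
  refine ⟨f, fun ξ hξ => ?_, fun ξ hξ => ?_, fun γ ξ hξ => ?_⟩
  · have hreg : RegularSpace Mat2 := inferInstanceAs (RegularSpace (Fin 2 → Fin 2 → ℂ))
    have hD := isClosedEmbedding_embS O
    rw [ContinuousWithinAt, hD.isInducing.tendsto_nhds_iff]
    refine (closed_nhds_basis (embS O (f ξ))).tendsto_right_iff.2 fun N ⟨hN, hNc⟩ => ?_
    obtain ⟨V, hV, hVN⟩ := mem_comap.1 (hf ξ hξ hN)
    have h1 : ∀ᶠ η in 𝓝 ξ, V ∈ 𝓝 (embS O η) :=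
      hD.continuous.continuousAt.eventually (eventually_mem_nhds_iff.2 hV)
    filter_upwards [nhdsWithin_le_nhds h1, self_mem_nhdsWithin] with η hη hηΛ
    have := hne η hηΛ
    exact hNc.mem_of_tendsto (hf η hηΛ) (mem_of_superset (preimage_mem_comap hη) hVN)
  · have := hne ξ hξ
    exact mem_limitSet_of_tendsto (fun γ => ⟨γ, rfl⟩) (hf ξ hξ)
  · have := hne ξ hξ
    have h1 := tendsto_embH_act3 (ρ γ) (hf ξ hξ)
    have h2 : Tendsto (fun δ => γ * δ)
        (comap (fun γ : Γ => embH O (act3 γ O)) (𝓝 (embS O ξ)))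
        (comap (fun γ : Γ => embH O (act3 γ O)) (𝓝 (embS O (actS γ ξ)))) := by
      refine tendsto_comap_iff.2 ?_
      simpa only [Function.comp_def, Subgroup.coe_mul, act3_mul] using
        tendsto_embH_act3 (γ : PSL2C) (tendsto_comap (f := fun γ : Γ => embH O (act3 γ O))
          (x := 𝓝 (embS O ξ)))
    have h3 := (hf _ (actS_mem_limitSet γ.2 hξ)).comp h2
    simp only [Function.comp_def, map_mul, act3_mul] at h3
    exact embS_injective O (tendsto_nhds_unique h3 h1)

end Criterion

/-! ### Discreteness and properness -/

/-- The point `(0, 1)` of the upper half-space. -/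
def ptJ : H3 := ⟨(0, 1), one_pos⟩

lemma hypMat_ptJ : hypMat ptJ = 1 := by
  ext i j
  fin_cases i <;> fin_cases j <;> simp [hypMat, hermMat, ptJ]

lemma lorentz_actMat_one (A : SL2C) : lorentz (actMat A 1) 1 =
    Complex.normSq (A.1 0 0) + Complex.normSq (A.1 0 1) + Complex.normSq (A.1 1 0) +
      Complex.normSq (A.1 1 1) := by
  simp [lorentz, actMat, Matrix.mul_apply, Fin.sum_univ_two, Complex.normSq_apply,
    Matrix.conjTranspose_apply]
  ring

lemma normSq_apply_le_lorentz (A : SL2C) (i k : Fin 2) :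
    Complex.normSq (A.1 i k) ≤ lorentz (actMat A 1) 1 := by
  rw [lorentz_actMat_one]
  have h1 := Complex.normSq_nonneg (A.1 0 0)
  have h2 := Complex.normSq_nonneg (A.1 0 1)
  have h3 := Complex.normSq_nonneg (A.1 1 0)
  have h4 := Complex.normSq_nonneg (A.1 1 1)
  fin_cases i <;> fin_cases k <;> dsimp only [Fin.mk_zero, Fin.mk_one, Fin.zero_eta] <;> linarith

lemma normSq_out_apply_le (O : H3) (q : PSL2C) (i k : Fin 2) :
    Complex.normSq (q.out.1 i k) ≤ height O ptJ * (height O (act3 q O) * height O ptJ) := by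
  have h1 := normSq_apply_le_lorentz q.out i k
  have h2 : lorentz (actMat q.out 1) 1 = lorentz (hypMat (act3 q ptJ)) (hypMat ptJ) := by
    rw [hypMat_act3, hypMat_ptJ, pactMat]
  rw [h2] at h1
  have h3 := lorentz_hypMat_le_mul (act3 q ptJ) (act3 q O) ptJ
  have h4 := lorentz_hypMat_le_mul (act3 q O) O ptJ
  have h5 : lorentz (hypMat (act3 q ptJ)) (hypMat (act3 q O)) = height O ptJ := by
    rw [hypMat_act3, hypMat_act3, lorentz_pactMat, height]
  rw [lorentz_comm (hypMat O)] at h4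
  rw [h5] at h3
  exact h1.trans (h3.trans (mul_le_mul_of_nonneg_left h4 (height_pos O ptJ).le))

/-- An ultrafilter on matrices in `SL(2,ℂ)` with bounded entries converges. -/
lemma exists_tendsto_of_bounded {ι : Type*} (U : Ultrafilter ι) {A : ι → SL2C} {C : ℝ}
    (hA : ∀ i j k, Complex.normSq ((A i).1 j k) ≤ C) :
    ∃ M : Mat2, Tendsto (fun i => (A i).1) U (𝓝 M) := by
  have h : ∀ j k, ∃ m : ℂ, Tendsto (fun i => (A i).1 j k) U (𝓝 m) := fun j k => by
    have hmem : Metric.closedBall (0 : ℂ) (Real.sqrt C) ∈ U.map fun i => (A i).1 j k := by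
      refine Ultrafilter.mem_map.2 (Filter.mem_of_superset Filter.univ_mem fun i _ => ?_)
      rw [Set.mem_preimage, mem_closedBall_zero_iff]
      refine Real.le_sqrt_of_sq_le ?_
      rw [← Complex.normSq_eq_norm_sq]
      exact hA i j k
    obtain ⟨m, -, hm⟩ := (isCompact_closedBall (0 : ℂ) (Real.sqrt C)).ultrafilter_le_nhds' _ hmem
    exact ⟨m, hm⟩
  choose M hM using h
  exact ⟨Matrix.of M, tendsto_pi_nhds.2 fun j => tendsto_pi_nhds.2 fun k => hM j k⟩

lemma tendsto_SL2C_iff {ι : Type*} {l : Filter ι} {A : ι → SL2C} {B : SL2C} :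
    Tendsto A l (𝓝 B) ↔ Tendsto (fun i => (A i).1) l (𝓝 B.1) := by
  rw [nhds_induced, tendsto_comap_iff]
  rfl

lemma tendsto_inv_mul_one {ι : Type*} {l : Filter ι} [l.NeBot] {A A' : ι → SL2C} {M : Mat2}
    (hA : Tendsto (fun i => (A i).1) l (𝓝 M)) (hA' : Tendsto (fun i => (A' i).1) l (𝓝 M)) :
    Tendsto (fun i => (A i)⁻¹ * A' i) l (𝓝 1) := by
  have hdet : M.det = 1 := by
    have h1 : Tendsto (fun i => ((A i).1).det) l (𝓝 M.det) :=
      ((continuous_id.matrix_det).tendsto M).comp hA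
    simp only [Matrix.SpecialLinearGroup.det_coe] at h1
    exact tendsto_nhds_unique h1 tendsto_const_nhds
  have hc : Continuous fun P : Mat2 × Mat2 => Matrix.adjugate P.1 * P.2 :=
    continuous_fst.matrix_adjugate.matrix_mul continuous_snd
  have h3 := (hc.tendsto (M, M)).comp (hA.prodMk_nhds hA')
  rw [Matrix.adjugate_mul, hdet, one_smul] at h3
  rw [tendsto_SL2C_iff]
  simpa [Function.comp_def] using h3

/-- A discrete subgroup of `PSL(2,ℂ)` acts properly discontinuously on `ℍ³`. -/
lemma finite_height_le {Δ : Subgroup PSL2C} (hΔ : IsDiscreteSubgroup Δ) (O : H3) (C : ℝ) :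
    {q | q ∈ Δ ∧ height O (act3 q O) ≤ C}.Finite := by
  by_contra hinf
  set T := {q | q ∈ Δ ∧ height O (act3 q O) ≤ C} with hT
  have : Infinite T := Set.infinite_coe_iff.2 hinf
  set U := hyperfilter T with hU
  obtain ⟨M, hM⟩ := exists_tendsto_of_bounded U (A := fun q : T => q.1.out)
    (C := height O ptJ * (C * height O ptJ)) (fun q j k => by
      have hJ := height_pos O ptJ
      have hC := q.2.2
      refine (normSq_out_apply_le O q.1 j k).trans ?_
      gcongr)
  have h2 := tendsto_inv_mul_one (l := (U : Filter T) ×ˢ (U : Filter T))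
    (hM.comp tendsto_fst) (hM.comp tendsto_snd)
  obtain ⟨V, hVo, hV1, hV⟩ := hΔ 1 Δ.one_mem
  have hmk : Continuous (fun A : SL2C => (A : PSL2C)) := continuous_quotient_mk'
  have h4 := (hmk.tendsto (1 : SL2C)).comp h2
  have h5 := h4.eventually (hVo.mem_nhds hV1)
  have h6 : ∀ᶠ P : T × T in (U : Filter T) ×ˢ (U : Filter T), P.1 = P.2 := by
    filter_upwards [h5] with P hP
    simp only [Function.comp_apply] at hP
    rw [QuotientGroup.mk_mul, QuotientGroup.mk_inv, QuotientGroup.out_eq',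
      QuotientGroup.out_eq'] at hP
    have := hV _ (Δ.mul_mem (Δ.inv_mem P.1.2.1) P.2.2.1) hP
    exact Subtype.ext (inv_mul_eq_one.1 this)
  obtain ⟨q, hq⟩ := h6.curry.exists
  have h7 : ({q} : Set T)ᶜ ∈ U := Filter.compl_mem_hyperfilter_of_finite (Set.finite_singleton q)
  obtain ⟨r, hr1, hr2⟩ := (hq.and h7).exists
  exact hr2 hr1.symm

lemma tendsto_height_cofinite {Δ : Subgroup PSL2C} (hΔ : IsDiscreteSubgroup Δ) (O : H3)
    {ι : Type*} {j : ι → PSL2C} (hj : Function.Injective j) (hjΔ : ∀ i, j i ∈ Δ) :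
    Tendsto (fun i => height O (act3 (j i) O)) cofinite atTop := by
  refine tendsto_atTop.2 fun C => ?_
  refine eventually_cofinite.2 (((finite_height_le hΔ O C).preimage hj.injOn).subset
    fun i hi => ⟨hjΔ i, (lt_of_not_ge (show ¬ C ≤ height O (act3 (j i) O) from hi)).le⟩)

lemma pow_injective_of_ne_one {Δ : Subgroup PSL2C} (hΔ : IsTorsionFreeSubgroup Δ) {g : PSL2C}
    (hg : g ∈ Δ) (h1 : g ≠ 1) : Function.Injective fun n : ℕ => g ^ n := by
  rw [injective_pow_iff_not_isOfFinOrder, isOfFinOrder_iff_pow_eq_one]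
  rintro ⟨n, hn, h⟩
  exact h1 (hΔ g hg n hn h)

/-- Nontrivial elements of Kleinian groups have no fixed points in `ℍ³`. -/
lemma eq_one_of_act3_eq {Δ : Subgroup PSL2C} (hΔ : IsKleinian Δ) {g : PSL2C} (hg : g ∈ Δ)
    {p : H3} (hp : act3 g p = p) : g = 1 := by
  by_contra h1
  have hpow : ∀ n : ℕ, act3 (g ^ n) p = p := fun n => by
    induction n with
    | zero => rw [pow_zero, act3_one]
    | succ n ih => rw [pow_succ, act3_mul, hp, ih]
  refine Set.infinite_range_of_injective (pow_injective_of_ne_one hΔ.2 hg h1)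
    ((finite_height_le hΔ.1 p 2).subset ?_)
  rintro _ ⟨n, rfl⟩
  exact ⟨Δ.pow_mem hg n, by rw [hpow, height, lorentz_hypMat_self]⟩

/-! ### Elementary groups -/

lemma exists_add_bdMat_eq_smul {x y : OnePoint ℂ} (hxy : x ≠ y) {α β : ℝ} (hα : 0 < α)
    (hβ : 0 < β) : ∃ p : H3, ∃ k : ℝ, 0 < k ∧ α • bdMat x + β • bdMat y = k • hypMat p := by
  have hinf : ∀ (z : ℂ) (α β : ℝ), 0 < α → 0 < β →
      ∃ p : H3, ∃ k : ℝ, 0 < k ∧ α • bdMat ∞ + β • bdMat z = k • hypMat p := by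
    intro z α β hα hβ
    have h1 : 0 < Real.sqrt (α / β) := by positivity
    have h2 : Real.sqrt (α / β) ^ 2 = α / β := Real.sq_sqrt (by positivity)
    refine ⟨⟨(z, Real.sqrt (α / β)), h1⟩, β * Real.sqrt (α / β), by positivity, ?_⟩
    rw [hypMat, smul_smul, mul_assoc, mul_inv_cancel₀ h1.ne', mul_one, bdMat_infty, bdMat_coe]
    ext i j
    fin_cases i <;> fin_cases j
    · have : α + β * Complex.normSq z = β * (Complex.normSq z + Real.sqrt (α / β) ^ 2) := by
        rw [h2]; field_simp; ring
      simp only [hermMat, Matrix.add_apply, Matrix.smul_apply, Complex.real_smul]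
      simp
      exact_mod_cast this
    · simp [hermMat]
    · simp [hermMat]
    · simp [hermMat]
  induction x using OnePoint.rec with
  | infty =>
    induction y using OnePoint.rec with
    | infty => exact (hxy rfl).elim
    | coe w => exact hinf w α β hα hβ
  | coe z =>
    induction y using OnePoint.rec with
    | infty => rw [add_comm]; exact hinf z β α hβ hα
    | coe w =>
      have hzw : z - w ≠ 0 := fun h => hxy (by rw [sub_eq_zero.1 h])
      have h0 := Complex.normSq_pos.2 hzw
      have h1 : 0 < Real.sqrt (α * β * Complex.normSq (z - w)) / (α + β) := by positivity
      have h2 : (Real.sqrt (α * β * Complex.normSq (z - w)) / (α + β)) ^ 2 =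
          α * β * Complex.normSq (z - w) / (α + β) ^ 2 := by
        rw [div_pow, Real.sq_sqrt (by positivity)]
      set t := Real.sqrt (α * β * Complex.normSq (z - w)) / (α + β) with ht
      have hk : ((α : ℂ) + β) ≠ 0 := by exact_mod_cast (add_pos hα hβ).ne'
      refine ⟨⟨(((α + β)⁻¹ : ℝ) * (α * z + β * w), t), h1⟩, (α + β) * t, by positivity, ?_⟩
      rw [hypMat, smul_smul, mul_assoc, mul_inv_cancel₀ h1.ne', mul_one, bdMat_coe, bdMat_coe]
      ext i j
      fin_cases i <;> fin_cases j
      · have : α * (Complex.normSq z + 0 ^ 2) + β * (Complex.normSq w + 0 ^ 2) =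
            (α + β) * (Complex.normSq (((α + β)⁻¹ : ℝ) * ((α : ℂ) * z + β * w)) + t ^ 2) := by
          rw [h2]
          simp only [Complex.normSq_apply, Complex.mul_re, Complex.mul_im, Complex.add_re,
            Complex.add_im, Complex.ofReal_re, Complex.ofReal_im, Complex.sub_re,
            Complex.sub_im]
          field_simp
          ring
        show (α : ℂ) * ((Complex.normSq z + 0 ^ 2 : ℝ) : ℂ) +
            (β : ℂ) * ((Complex.normSq w + 0 ^ 2 : ℝ) : ℂ) = ((α + β : ℝ) : ℂ) *
            ((Complex.normSq (((α + β)⁻¹ : ℝ) * ((α : ℂ) * z + β * w)) + t ^ 2 : ℝ) : ℂ)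
        exact_mod_cast this
      · simp [hermMat]
        field_simp
      · simp [hermMat]
        field_simp
      · simp [hermMat]

/-- An element of a Kleinian group cannot exchange two points of the sphere. -/
lemma eq_of_actS_swap {Δ : Subgroup PSL2C} (hΔ : IsKleinian Δ) {g : PSL2C} (hg : g ∈ Δ)
    {x y : OnePoint ℂ} (hx : actS g x = y) (hy : actS g y = x) : x = y := by
  by_contra hxy
  obtain ⟨r, hr, h1⟩ := pactMat_bdMat g x
  obtain ⟨s, hs, h2⟩ := pactMat_bdMat g y
  rw [hx] at h1
  rw [hy] at h2
  have hL : 0 < lorentz (bdMat x) (bdMat y) :=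
    lt_of_le_of_ne (lorentz_bdMat_nonneg x y) fun h => hxy (lorentz_bdMat_eq_zero.1 h.symm)
  have hrs : s = r⁻¹ := by
    have h3 := lorentz_pactMat g (bdMat x) (bdMat y)
    rw [h1, h2, lorentz_smul_left, lorentz_smul_right, lorentz_comm (bdMat y)] at h3
    have : r * s = 1 := by
      refine mul_right_cancel₀ hL.ne' ?_
      linarith
    exact eq_inv_of_mul_eq_one_right this
  obtain ⟨p, k, hk, hp⟩ := exists_add_bdMat_eq_smul hxy one_pos hr
  have hfix : act3 g p = p := by
    refine hypMat_injective (smul_right_injective Mat2 hk.ne' ?_)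
    show k • hypMat (act3 g p) = k • hypMat p
    rw [hypMat_act3, ← pactMat_smul, ← hp, pactMat_add, pactMat_smul, pactMat_smul, h1, h2, hrs,
      smul_smul, smul_smul, one_mul, mul_inv_cancel₀ hr.ne', add_comm]
  exact hxy (by rw [← hx, eq_one_of_act3_eq hΔ hg hfix, actS_one])

lemma act3_mk (A : SL2C) (p : H3) : act3 (A : PSL2C) p = act3SL A p := by
  apply hypMat_injective
  rw [hypMat_act3, pactMat_mk, hypMat_act3SL]

lemma height_ptJ_act3_mk (A : SL2C) : height ptJ (act3 (A : PSL2C) ptJ) =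
    Complex.normSq (A.1 0 0) + Complex.normSq (A.1 0 1) + Complex.normSq (A.1 1 0) +
      Complex.normSq (A.1 1 1) := by
  rw [height, hypMat_act3, hypMat_ptJ, pactMat_mk, lorentz_actMat_one]

lemma apply_one_zero_eq_zero_of_actS_infty {A : SL2C} (h : actS (A : PSL2C) ∞ = ∞) :
    A.1 1 0 = 0 := by
  obtain ⟨r, hr, h1⟩ := pactMat_bdMat (A : PSL2C) ∞
  rw [h, pactMat_mk] at h1
  have h2 := congrFun (congrFun h1 1) 1
  simpa [actMat, bdMat_infty, Matrix.mul_apply, Fin.sum_univ_two] using h2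

lemma mem_center_apply {A : SL2C} (h : A ∈ Subgroup.center SL2C) :
    A.1 0 1 = 0 ∧ A.1 0 0 ^ 2 = 1 := by
  obtain ⟨r, hr, h1⟩ := Matrix.SpecialLinearGroup.mem_center_iff.1 h
  rw [← h1]
  simpa using hr

/-- Conjugating a translation by an element fixing infinity. -/
lemma conj_translation {A B : SL2C} (hA : A.1 1 0 = 0) (h00 : B.1 0 0 = 1) (h10 : B.1 1 0 = 0)
    (h11 : B.1 1 1 = 1) : (A * B * A⁻¹).1 0 0 = 1 ∧ (A * B * A⁻¹).1 1 0 = 0 ∧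
      (A * B * A⁻¹).1 1 1 = 1 ∧ (A * B * A⁻¹).1 0 1 = A.1 0 0 ^ 2 * B.1 0 1 := by
  have hd := det_eq A
  simp only [Matrix.SpecialLinearGroup.coe_mul, Matrix.SpecialLinearGroup.coe_inv,
    Matrix.adjugate_fin_two, Matrix.mul_apply, Fin.sum_univ_two, hA, h00, h10, h11,
    Matrix.of_apply, Matrix.cons_val', Matrix.cons_val_zero, Matrix.cons_val_one,
    Matrix.cons_val_fin_one] at hd ⊢
  refine ⟨by linear_combination hd, by ring, by linear_combination hd, by ring⟩

/-- If a discrete group fixing infinity contains a translation, it contains no element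
contracting the plane. -/
lemma one_le_norm_of_translation {Δ : Subgroup PSL2C}
    (hfin : ∀ C : ℝ, {q | q ∈ Δ ∧ height ptJ (act3 q ptJ) ≤ C}.Finite) {A B : SL2C}
    (hAΔ : (A : PSL2C) ∈ Δ) (hBΔ : (B : PSL2C) ∈ Δ) (hA : A.1 1 0 = 0) (h00 : B.1 0 0 = 1)
    (h10 : B.1 1 0 = 0) (h11 : B.1 1 1 = 1) (h01 : B.1 0 1 ≠ 0) : 1 ≤ ‖A.1 0 0‖ := by
  by_contra! hlt
  have hex : ∀ n : ℕ, ∃ D : SL2C, (D : PSL2C) ∈ Δ ∧ D.1 0 0 = 1 ∧ D.1 1 0 = 0 ∧ D.1 1 1 = 1 ∧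
      D.1 0 1 = (A.1 0 0 ^ 2) ^ n * B.1 0 1 := fun n => by
    induction n with
    | zero => exact ⟨B, hBΔ, h00, h10, h11, by rw [pow_zero, one_mul]⟩
    | succ n ih =>
      obtain ⟨D, hD, d00, d10, d11, d01⟩ := ih
      obtain ⟨e00, e10, e11, e01⟩ := conj_translation hA d00 d10 d11
      refine ⟨A * D * A⁻¹, Δ.mul_mem (Δ.mul_mem hAΔ hD) (Δ.inv_mem hAΔ), e00, e10, e11, ?_⟩
      rw [e01, d01, pow_succ]
      ring
  choose D hD d00 d10 d11 d01 using hex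
  have hmem : ∀ n, (D n : PSL2C) ∈
      {q | q ∈ Δ ∧ height ptJ (act3 q ptJ) ≤ 2 + Complex.normSq (B.1 0 1)} := fun n => by
    refine ⟨hD n, ?_⟩
    rw [height_ptJ_act3_mk, d00, d10, d11, d01, map_mul, Complex.normSq_eq_norm_sq (_ ^ n),
      norm_pow, norm_pow, map_one, map_zero]
    have h1 : ((‖A.1 0 0‖ ^ 2) ^ n) ^ 2 ≤ 1 := by
      rw [← pow_mul, ← pow_mul]
      exact pow_le_one₀ (norm_nonneg _) hlt.le
    have := Complex.normSq_nonneg (B.1 0 1)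
    nlinarith
  have hinj : Function.Injective fun n => (D n : PSL2C) := by
    intro n m hnm
    have h1 := (mem_center_apply (QuotientGroup.eq.1 hnm)).1
    simp only [Matrix.SpecialLinearGroup.coe_mul, Matrix.SpecialLinearGroup.coe_inv,
      Matrix.adjugate_fin_two, Matrix.mul_apply, Fin.sum_univ_two, d11, d01,
      Matrix.of_apply, Matrix.cons_val', Matrix.cons_val_zero, Matrix.cons_val_one,
      Matrix.cons_val_fin_one] at h1
    have h2 : (A.1 0 0 ^ 2) ^ m = (A.1 0 0 ^ 2) ^ n :=
      mul_right_cancel₀ h01 (by linear_combination h1)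
    have h3 : (‖A.1 0 0‖ ^ 2) ^ n = (‖A.1 0 0‖ ^ 2) ^ m := by
      rw [← norm_pow, ← norm_pow, ← norm_pow, h2]
    have h4 : A.1 0 0 ≠ 0 := fun h => by
      have := det_eq A
      rw [hA, h] at this
      simp at this
    have h5 : 0 < ‖A.1 0 0‖ := norm_pos_iff.2 h4
    exact (pow_right_strictAnti₀ (by positivity) (by nlinarith)).injective h3
  exact Set.infinite_range_of_injective hinj ((hfin _).subset (Set.range_subset_iff.2 hmem))

/-- An upper triangular matrix with unimodular, nonreal eigenvalues is elliptic. -/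
lemma exists_act3_eq_of_norm_eq_one {A : SL2C} (hA : A.1 1 0 = 0) (h1 : ‖A.1 0 0‖ = 1)
    (h2 : A.1 0 0 ^ 2 ≠ 1) : ∃ p, act3 (A : PSL2C) p = p := by
  have hd := det_eq A
  rw [hA, mul_zero, sub_zero] at hd
  have hn : Complex.normSq (A.1 1 1) = 1 := by
    have := congrArg norm hd
    rw [norm_mul, h1, one_mul, norm_one] at this
    rw [Complex.normSq_eq_norm_sq, this, one_pow]
  have hc : conj (A.1 1 1) = A.1 0 0 := by
    have h3 := Complex.mul_conj (A.1 1 1)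
    rw [hn] at h3
    push_cast at h3
    linear_combination A.1 0 0 * h3 - conj (A.1 1 1) * hd
  have h3 : 1 - A.1 0 0 ^ 2 ≠ 0 := sub_ne_zero.2 h2.symm
  refine ⟨⟨(A.1 0 0 * A.1 0 1 / (1 - A.1 0 0 ^ 2), 1), one_pos⟩, ?_⟩
  rw [act3_mk]
  refine Subtype.ext (Prod.ext ?_ ?_)
  · simp only [act3SL, hA, zero_mul, zero_add, map_zero, mul_zero, add_zero, hn, hc,
      Complex.ofReal_one, div_one]
    field_simp
    ring
  · simp [act3SL, hA, hn]

lemma commute_of_actS_infty {Δ : Subgroup PSL2C}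
    (hfin : ∀ C : ℝ, {q | q ∈ Δ ∧ height ptJ (act3 q ptJ) ≤ C}.Finite)
    (hfree : ∀ g ∈ Δ, ∀ p, act3 g p = p → g = 1) (hinf : ∀ g ∈ Δ, actS g ∞ = ∞)
    {x y : PSL2C} (hx : x ∈ Δ) (hy : y ∈ Δ) : x * y = y * x := by
  by_contra hxy
  obtain ⟨X, rfl⟩ := QuotientGroup.mk_surjective x
  obtain ⟨Y, rfl⟩ := QuotientGroup.mk_surjective y
  have hlow : ∀ A : SL2C, (A : PSL2C) ∈ Δ → A.1 1 0 = 0 := fun A hA =>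
    apply_one_zero_eq_zero_of_actS_infty (hinf _ hA)
  have hX := hlow X hx
  have hY := hlow Y hy
  have hdX := det_eq X
  have hdY := det_eq Y
  rw [hX, mul_zero, sub_zero] at hdX
  rw [hY, mul_zero, sub_zero] at hdY
  have hne : X * Y ≠ Y * X := fun h => hxy (by
    rw [← QuotientGroup.mk_mul, ← QuotientGroup.mk_mul, h])
  obtain ⟨B, hB, h00, h10, h11, h01⟩ : ∃ B : SL2C, (B : PSL2C) ∈ Δ ∧ B.1 0 0 = 1 ∧
      B.1 1 0 = 0 ∧ B.1 1 1 = 1 ∧ B.1 0 1 ≠ 0 := by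
    have hBΔ : ((X * Y * X⁻¹ * Y⁻¹ : SL2C) : PSL2C) ∈ Δ :=
      Δ.mul_mem (Δ.mul_mem (Δ.mul_mem hx hy) (Δ.inv_mem hx)) (Δ.inv_mem hy)
    have e10 := hlow _ hBΔ
    have e00 : (X * Y * X⁻¹ * Y⁻¹).1 0 0 = 1 := by
      simp only [Matrix.SpecialLinearGroup.coe_mul, Matrix.SpecialLinearGroup.coe_inv,
        Matrix.adjugate_fin_two, Matrix.mul_apply, Fin.sum_univ_two, hX, hY,
        Matrix.of_apply, Matrix.cons_val', Matrix.cons_val_zero, Matrix.cons_val_one,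
        Matrix.cons_val_fin_one]
      linear_combination Y.1 0 0 * Y.1 1 1 * hdX + hdY
    have e11 : (X * Y * X⁻¹ * Y⁻¹).1 1 1 = 1 := by
      have := det_eq (X * Y * X⁻¹ * Y⁻¹)
      rwa [e10, e00, one_mul, mul_zero, sub_zero] at this
    refine ⟨_, hBΔ, e00, e10, e11, fun e01 => hne ?_⟩
    have : X * Y * X⁻¹ * Y⁻¹ = 1 := by
      ext i j
      fin_cases i <;> fin_cases j
      · simpa using e00
      · simpa using e01
      · simpa using e10
      · simpa using e11
    rw [mul_inv_eq_one, mul_inv_eq_iff_eq_mul] at this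
    exact this
  have hsq : ∀ A : SL2C, (A : PSL2C) ∈ Δ → A.1 0 0 ^ 2 = 1 := fun A hA => by
    by_contra h2
    have hA0 := hlow A hA
    have hd := det_eq A
    rw [hA0, mul_zero, sub_zero] at hd
    have hle := one_le_norm_of_translation hfin hA hB hA0 h00 h10 h11 h01
    have hge := one_le_norm_of_translation hfin (A := A⁻¹) (Δ.inv_mem hA) hB
      (hlow _ (Δ.inv_mem hA)) h00 h10 h11 h01
    have h3 : (A⁻¹).1 0 0 = A.1 1 1 := by
      simp [Matrix.adjugate_fin_two]
    rw [h3] at hge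
    have h4 := congrArg norm hd
    rw [norm_mul, norm_one] at h4
    obtain ⟨p, hp⟩ := exists_act3_eq_of_norm_eq_one hA0 (by nlinarith) h2
    have h5 := hfree _ hA p hp
    exact h2 (mem_center_apply ((QuotientGroup.eq_one_iff A).1 h5)).2
  have hXs := hsq X hx
  have hYs := hsq Y hy
  have hXd : X.1 1 1 = X.1 0 0 := by linear_combination X.1 0 0 * hdX - X.1 1 1 * hXs
  have hYd : Y.1 1 1 = Y.1 0 0 := by linear_combination Y.1 0 0 * hdY - Y.1 1 1 * hYs
  refine hne ?_
  ext i j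
  fin_cases i <;> fin_cases j <;>
    simp [Matrix.mul_apply, Fin.sum_univ_two, hX, hY, hXd, hYd] <;> ring

lemma exists_actS_infty_eq (ξ : OnePoint ℂ) : ∃ P : PSL2C, actS P ∞ = ξ := by
  induction ξ using OnePoint.rec with
  | infty => exact ⟨1, actS_one _⟩
  | coe z =>
    have hd : (!![z, -1; 1, 0] : Mat2).det = 1 := by simp [Matrix.det_fin_two]
    obtain ⟨A, hA⟩ : ∃ A : SL2C, A.1 = !![z, -1; 1, 0] := ⟨⟨_, hd⟩, rfl⟩
    obtain ⟨r, hr, h1⟩ := pactMat_bdMat (A : PSL2C) ∞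
    refine ⟨_, eq_of_bdMat_eq_smul hr.ne' (h1.symm.trans (?_ : _ = (1 : ℝ) • bdMat z))⟩
    rw [pactMat_mk, one_smul, bdMat_coe]
    ext i j
    fin_cases i <;> fin_cases j <;>
      simp [hA, actMat, bdMat_infty, hermMat, Matrix.mul_apply, Fin.sum_univ_two, Complex.mul_conj,
        Matrix.conjTranspose_apply]

/-- A Kleinian group fixing a point of the sphere is abelian. -/
lemma commute_of_forall_actS_eq {Δ : Subgroup PSL2C} (hΔ : IsKleinian Δ) {ξ : OnePoint ℂ}
    (hξ : ∀ g ∈ Δ, actS g ξ = ξ) {x y : PSL2C} (hx : x ∈ Δ) (hy : y ∈ Δ) : x * y = y * x := by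
  obtain ⟨P, hP⟩ := exists_actS_infty_eq ξ
  have hfin : ∀ C : ℝ, {q | q ∈ Δ.map (MulAut.conj P⁻¹).toMonoidHom ∧
      height ptJ (act3 q ptJ) ≤ C}.Finite := fun C => by
    refine ((finite_height_le hΔ.1 (act3 P ptJ) C).image (MulAut.conj P⁻¹)).subset ?_
    rintro _ ⟨⟨g, hg, rfl⟩, h⟩
    refine ⟨g, ⟨hg, ?_⟩, rfl⟩
    refine le_of_eq_of_le ?_ h
    simp only [height, MulEquiv.coe_toMonoidHom, MulAut.conj_apply, inv_inv, act3_mul]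
    rw [hypMat_act3 P⁻¹, lorentz_pactMat_left, inv_inv, ← hypMat_act3]
  have h := commute_of_actS_infty hfin ?_ ?_ (Subgroup.mem_map_of_mem _ hx)
    (Subgroup.mem_map_of_mem _ hy)
  · rw [← map_mul, ← map_mul] at h
    exact (MulAut.conj P⁻¹).injective h
  · rintro _ ⟨g, hg, rfl⟩ p hp
    simp only [MulEquiv.coe_toMonoidHom, MulAut.conj_apply, inv_inv, act3_mul] at hp
    have h1 := congrArg (act3 P) hp
    rw [act3_act3_inv] at h1
    rw [eq_one_of_act3_eq hΔ hg h1, map_one]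
  · rintro _ ⟨g, hg, rfl⟩
    simp only [MulEquiv.coe_toMonoidHom, MulAut.conj_apply, inv_inv, actS_mul]
    rw [hP, hξ g hg, ← hP, actS_inv_actS]

/-! ### Dynamics on the sphere -/

lemma height_act3_inv (O : H3) (q : PSL2C) : height O (act3 q⁻¹ O) = height O (act3 q O) := by
  rw [height, height, hypMat_act3, hypMat_act3, lorentz_pactMat_left, inv_inv, lorentz_comm]

lemma lorentz_embH_embS_actS (O : H3) (q : PSL2C) (η : OnePoint ℂ) :
    lorentz (embH O (act3 q O)) (embS O (actS q η)) * height O (act3 q O) ^ 2 *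
      lorentz (embH O (act3 q⁻¹ O)) (embS O η) = 1 := by
  obtain ⟨r, hr, h⟩ := pactMat_bdMat q η
  have h1 : embS O (actS q η) = normMat O (pactMat q (bdMat η)) := by
    rw [h, normMat_smul O hr.ne', embS]
  have h2 := height_act3_inv O q
  have h3 := height_pos O (act3 q O)
  have h4 := lorentz_bdMat_hypMat_pos η O
  have h5 := lorentz_bdMat_hypMat_pos η (act3 q⁻¹ O)
  have h6 : lorentz (pactMat q (bdMat η)) (hypMat O) =
      lorentz (bdMat η) (hypMat (act3 q⁻¹ O)) := by
    rw [lorentz_pactMat_left, hypMat_act3]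
  have h7 : lorentz (hypMat (act3 q O)) (pactMat q (bdMat η)) =
      lorentz (bdMat η) (hypMat O) := by
    rw [hypMat_act3, lorentz_pactMat, lorentz_comm]
  rw [h1, embS, embH, embH, normMat, normMat, normMat, normMat]
  simp only [lorentz_smul_left, lorentz_smul_right]
  rw [h6, h7, lorentz_comm (hypMat (act3 q⁻¹ O)) (bdMat η)]
  change _ * ((height O (act3 q O))⁻¹ * _) * _ * (_ * ((height O (act3 q⁻¹ O))⁻¹ * _)) = 1
  rw [h2]
  field_simp

/-- A divergent sequence of isometries contracts the sphere away from its repelling point. -/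
lemma tendsto_actS {O : H3} {ι : Type*} (U : Ultrafilter ι) {q : ι → PSL2C}
    {ξ b η : OnePoint ℂ} (h1 : Tendsto (fun i => embH O (act3 (q i) O)) U (𝓝 (embS O ξ)))
    (h2 : Tendsto (fun i => embH O (act3 (q i)⁻¹ O)) U (𝓝 (embS O b))) (hη : η ≠ b) :
    Tendsto (fun i => actS (q i) η) U (𝓝 ξ) := by
  obtain ⟨ζ, hζ⟩ : ∃ ζ, Tendsto (fun i => actS (q i) η) U (𝓝 ζ) :=
    ⟨(U.map fun i => actS (q i) η).lim, Ultrafilter.le_nhds_lim _⟩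
  have h3 : Tendsto (fun i => lorentz (embH O (act3 (q i) O)) (embS O (actS (q i) η))) U
      (𝓝 (lorentz (embS O ξ) (embS O ζ))) :=
    tendsto_lorentz h1 (((isClosedEmbedding_embS O).continuous.tendsto ζ).comp hζ)
  have h4 : Tendsto (fun i => lorentz (embH O (act3 (q i)⁻¹ O)) (embS O η)) U
      (𝓝 (lorentz (embS O b) (embS O η))) := tendsto_lorentz h2 tendsto_const_nhds
  have h5 : lorentz (embS O b) (embS O η) ≠ 0 := fun h => hη (lorentz_embS_eq_zero.1 h).symm
  have h6 := tendsto_height_of_tendsto_embS h1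
  have h7 : Tendsto (fun i => ((height O (act3 (q i) O)) ^ 2)⁻¹) U (𝓝 0) :=
    tendsto_inv_atTop_zero.comp ((tendsto_pow_atTop two_ne_zero).comp h6)
  have h8 := (h3.mul h4).congr' (f₂ := fun i => ((height O (act3 (q i) O)) ^ 2)⁻¹)
    (Eventually.of_forall fun i => by
      have := height_pos O (act3 (q i) O)
      have := lorentz_embH_embS_actS O (q i) η
      field_simp
      linarith)
  have h9 := (mul_eq_zero.1 (tendsto_nhds_unique h8 h7)).resolve_right h5
  rwa [lorentz_embS_eq_zero.1 h9]

/-- An isometry commuting with a divergent sequence fixes its attracting point. -/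
lemma actS_eq_of_commute {O : H3} {ι : Type*} {l : Filter ι} [l.NeBot] {q : ι → PSL2C}
    {ξ : OnePoint ℂ} (h : Tendsto (fun i => embH O (act3 (q i) O)) l (𝓝 (embS O ξ)))
    {g : PSL2C} (hg : ∀ i, g * q i = q i * g) : actS g ξ = ξ := by
  have h1 := tendsto_lorentz h (tendsto_embH_act3 g h)
  have h2 : Tendsto (fun i => lorentz (hypMat O) (hypMat (act3 g O)) / 2 *
      (height O (act3 (q i) O))⁻¹) l (𝓝 0) := by
    simpa using (tendsto_inv_atTop_zero.comp (tendsto_height_of_tendsto_embS h)).const_mul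
      (lorentz (hypMat O) (hypMat (act3 g O)) / 2)
  have h3 := squeeze_zero (fun i => (lorentz_embH_pos O (act3 (q i) O)
    (act3 g (act3 (q i) O))).le) (fun i => ?_) h2
  · exact (lorentz_embS_eq_zero.1 (tendsto_nhds_unique h1 h3)).symm
  · have h4 := height_pos O (act3 (q i) O)
    have h5 := height_ge_two O (act3 g (act3 (q i) O))
    have h6 := lorentz_hypMat_pos O (act3 g O)
    rw [lorentz_embH, ← act3_mul g, hg, act3_mul, hypMat_act3 (q i), hypMat_act3 (q i),
      lorentz_pactMat, ← act3_mul, ← hg, act3_mul, ← div_eq_mul_inv, div_div, mul_comm]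
    gcongr

section Extension

variable {Γ : Subgroup PSL2C} {O : H3} {ρ : Γ →* PSL2C} {f : OnePoint ℂ → OnePoint ℂ}

/-- For a nonelementary group, no point of the sphere and point of the target sphere can
account for all of the graph of a Cannon–Thurston map. -/
lemma exists_mem_limitSet_ne (hΓ : IsKleinian Γ) (hG : IsKleinian ρ.range)
    (hρ : Function.Injective ρ) (hf : IsCTMap Γ ρ O f) (hne : (limitSet Γ O).Nonempty)
    (hna : ¬ ∀ x y : Γ, x * y = y * x) (b b' : OnePoint ℂ) :
    ∃ η ∈ limitSet Γ O, η ≠ b ∧ f η ≠ b' := by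
  by_contra! H
  have hfix : ∀ ζ, ¬ ∀ g ∈ Γ, actS g ζ = ζ := fun ζ hζ =>
    hna fun x y => Subtype.ext (commute_of_forall_actS_eq hΓ hζ x.2 y.2)
  have hex : ∃ g : Γ, ∀ η ∈ limitSet Γ O, η ≠ b → actS g η = b := by
    by_contra! H1
    refine hna fun x y => hρ ?_
    rw [map_mul, map_mul]
    refine commute_of_forall_actS_eq hG (ξ := b') ?_ ⟨x, rfl⟩ ⟨y, rfl⟩
    rintro _ ⟨g, rfl⟩
    obtain ⟨η, hη, hηb, hgη⟩ := H1 g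
    have h1 := hf.2.2 g η hη
    rw [H η hη hηb, H _ (actS_mem_limitSet g.2 hη) hgη] at h1
    exact h1.symm
  obtain ⟨g, hg⟩ := hex
  have huniq : ∀ η ∈ limitSet Γ O, ∀ ζ ∈ limitSet Γ O, η ≠ b → ζ ≠ b → η = ζ :=
    fun η hη ζ hζ h1 h2 => actS_injective g ((hg η hη h1).trans (hg ζ hζ h2).symm)
  obtain ⟨x, hx⟩ := hne
  by_cases hxx : ∃ y ∈ limitSet Γ O, y ≠ x
  · obtain ⟨y, hy, hyx⟩ := hxx
    have hmem : ∀ z ∈ limitSet Γ O, z = x ∨ z = y := fun z hz => by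
      by_contra! hz'
      by_cases hxb : x = b
      · subst hxb
        exact hz'.2 (huniq z hz y hy hz'.1 hyx)
      · by_cases hyb : y = b
        · subst hyb
          exact hz'.1 (huniq z hz x hx hz'.2 hxb)
        · exact hyx (huniq y hy x hx hyb hxb)
    refine hfix x fun k hk => (hmem _ (actS_mem_limitSet hk hx)).resolve_right fun hkx => ?_
    rcases hmem _ (actS_mem_limitSet hk hy) with hky | hky
    · exact hyx (eq_of_actS_swap hΓ hk hkx hky).symm
    · exact hyx (actS_injective k (hky.trans hkx.symm))
  · push Not at hxx
    exact hfix x fun k hk => hxx _ (actS_mem_limitSet hk hx)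

lemma eq_image_of_tendsto (hΓ : IsKleinian Γ) (hG : IsKleinian ρ.range)
    (hρ : Function.Injective ρ) (hf : IsCTMap Γ ρ O f) (hne : (limitSet Γ O).Nonempty)
    (hna : ¬ ∀ x y : Γ, x * y = y * x) {ι : Type*} (U : Ultrafilter ι) {γ : ι → Γ}
    {ξ a : OnePoint ℂ} (h1 : Tendsto (fun i => embH O (act3 (γ i) O)) U (𝓝 (embS O ξ)))
    (h2 : Tendsto (fun i => embH O (act3 (ρ (γ i)) O)) U (𝓝 (embS O a))) : a = f ξ := by
  obtain ⟨b, hb⟩ := exists_tendsto_embS (O := O) U (p := fun i => act3 (γ i : PSL2C)⁻¹ O) (by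
    simpa only [height_act3_inv] using tendsto_height_of_tendsto_embS h1)
  obtain ⟨b', hb'⟩ := exists_tendsto_embS (O := O) U (p := fun i => act3 (ρ (γ i))⁻¹ O) (by
    simpa only [height_act3_inv] using tendsto_height_of_tendsto_embS h2)
  obtain ⟨η, hη, hηb, hfη⟩ := exists_mem_limitSet_ne hΓ hG hρ hf hne hna b b'
  have hξ : ξ ∈ limitSet Γ O := mem_limitSet_of_tendsto (fun i => (γ i).2) h1
  have h3 := (hf.1 ξ hξ).tendsto.comp (tendsto_nhdsWithin_iff.2 ⟨tendsto_actS U h1 hb hηb,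
    Eventually.of_forall fun i => actS_mem_limitSet (γ i).2 hη⟩)
  have h4 := tendsto_actS U h2 hb' hfη
  simp only [Function.comp_def, hf.2.2 _ η hη] at h3
  exact tendsto_nhds_unique h4 h3

end Extension

/-! ### Dilation factors at fixed points -/

/-- The stabilizer of a point of the sphere. -/
def fixS (ξ : OnePoint ℂ) : Subgroup PSL2C where
  carrier := {q | actS q ξ = ξ}
  mul_mem' {q r} hq hr := by
    rw [Set.mem_ofPred_eq] at *
    rw [actS_mul, hr, hq]
  one_mem' := actS_one ξ
  inv_mem' {q} hq := by
    rw [Set.mem_ofPred_eq] at *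
    rw [← hq, actS_inv_actS, hq]

lemma mem_fixS {ξ : OnePoint ℂ} {q : PSL2C} : q ∈ fixS ξ ↔ actS q ξ = ξ := Iff.rfl

/-- The factor by which an isometry fixing `ξ` scales the matrix of `ξ`. -/
def dil (q : PSL2C) (ξ : OnePoint ℂ) : ℝ :=
  lorentz (pactMat q (bdMat ξ)) (hypMat ptJ) / lorentz (bdMat ξ) (hypMat ptJ)

lemma pactMat_bdMat_of_mem_fixS {q : PSL2C} {ξ : OnePoint ℂ} (h : q ∈ fixS ξ) :
    0 < dil q ξ ∧ pactMat q (bdMat ξ) = dil q ξ • bdMat ξ := by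
  obtain ⟨r, hr, h1⟩ := pactMat_bdMat q ξ
  have h2 := (lorentz_bdMat_hypMat_pos ξ ptJ).ne'
  rw [mem_fixS.1 h] at h1
  have h3 : dil q ξ = r := by
    rw [dil, h1, lorentz_smul_left, mul_div_assoc, div_self h2, mul_one]
  rw [h3]
  exact ⟨hr, h1⟩

lemma dil_mul {q r : PSL2C} {ξ : OnePoint ℂ} (hq : q ∈ fixS ξ) (hr : r ∈ fixS ξ) :
    dil (q * r) ξ = dil q ξ * dil r ξ := by
  have h2 := (lorentz_bdMat_hypMat_pos ξ ptJ).ne'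
  rw [dil, pactMat_mul, (pactMat_bdMat_of_mem_fixS hr).2, pactMat_smul,
    (pactMat_bdMat_of_mem_fixS hq).2, smul_smul, lorentz_smul_left, mul_div_assoc, div_self h2,
    mul_one, mul_comm]

lemma dil_mul_dil {q : PSL2C} {ξ η : OnePoint ℂ} (hξ : q ∈ fixS ξ) (hη : q ∈ fixS η)
    (h : ξ ≠ η) : dil q ξ * dil q η = 1 := by
  have h1 := lorentz_pactMat q (bdMat ξ) (bdMat η)
  rw [(pactMat_bdMat_of_mem_fixS hξ).2, (pactMat_bdMat_of_mem_fixS hη).2, lorentz_smul_left,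
    lorentz_smul_right, ← mul_assoc] at h1
  exact mul_eq_right₀ (fun h0 => h (lorentz_bdMat_eq_zero.1 h0)) |>.1 h1

/-- The logarithm of the dilation factor. -/
def logDil (ξ : OnePoint ℂ) : Additive (fixS ξ) →+ ℝ :=
  AddMonoidHom.mk' (fun q => Real.log (dil (q.toMul : fixS ξ) ξ)) fun q r => by
    have h1 := (pactMat_bdMat_of_mem_fixS q.toMul.2).1
    have h2 := (pactMat_bdMat_of_mem_fixS r.toMul.2).1
    rw [toMul_add, Subgroup.coe_mul, dil_mul q.toMul.2 r.toMul.2, Real.log_mul h1.ne' h2.ne']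

lemma lorentz_embH_bdMat_of_mem_fixS (O : H3) {q : PSL2C} {ξ : OnePoint ℂ} (h : q ∈ fixS ξ) :
    lorentz (embH O (act3 q O)) (bdMat ξ) =
      lorentz (bdMat ξ) (hypMat O) * (dil q ξ)⁻¹ * (height O (act3 q O))⁻¹ := by
  obtain ⟨h1, h2⟩ := pactMat_bdMat_of_mem_fixS h
  have h3 : lorentz (hypMat (act3 q O)) (bdMat ξ) * dil q ξ = lorentz (bdMat ξ) (hypMat O) := by
    rw [mul_comm, ← lorentz_smul_right, ← h2, hypMat_act3, lorentz_pactMat, lorentz_comm]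
  have h4 := height_pos O (act3 q O)
  rw [embH, normMat, lorentz_smul_left, ← h3]
  change (height O (act3 q O))⁻¹ * _ = _
  field_simp

lemma lorentz_embH_bdMat_of_mem_fixS' (O : H3) {q : PSL2C} {ξ η : OnePoint ℂ} (h : q ∈ fixS ξ)
    (hη : q ∈ fixS η) (hne : ξ ≠ η) : lorentz (embH O (act3 q O)) (bdMat η) =
      lorentz (bdMat η) (hypMat O) * dil q ξ * (height O (act3 q O))⁻¹ := by
  rw [lorentz_embH_bdMat_of_mem_fixS O hη, ← eq_inv_of_mul_eq_one_left
    (dil_mul_dil h hη hne)]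

/-- Isometries moving the base point towards a fixed point expand there. -/
lemma eventually_one_lt_dil {O : H3} {ι : Type*} {l : Filter ι} {q : ι → PSL2C}
    {ξ η : OnePoint ℂ} (hne : ξ ≠ η) (hξ : ∀ i, q i ∈ fixS ξ) (hη : ∀ i, q i ∈ fixS η)
    (h : Tendsto (fun i => embH O (act3 (q i) O)) l (𝓝 (embS O ξ))) :
    ∀ᶠ i in l, 1 < dil (q i) ξ := by
  have h1 : Tendsto (fun i => lorentz (embH O (act3 (q i) O)) (bdMat η)) l
      (𝓝 (lorentz (embS O ξ) (bdMat η))) := tendsto_lorentz h tendsto_const_nhds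
  have hc : 0 < lorentz (embS O ξ) (bdMat η) :=
    (lorentz_embS_bdMat_nonneg O ξ η).lt_of_ne fun h0 => hne (lorentz_embS_bdMat_eq_zero.1 h0.symm)
  have h2 : Tendsto (fun i => lorentz (bdMat η) (hypMat O) * (height O (act3 (q i) O))⁻¹) l
      (𝓝 0) := by
    simpa using (tendsto_inv_atTop_zero.comp (tendsto_height_of_tendsto_embS h)).const_mul
      (lorentz (bdMat η) (hypMat O))
  filter_upwards [h2.eventually_lt h1 hc] with i hi
  rw [lorentz_embH_bdMat_of_mem_fixS' O (hξ i) (hη i) hne, mul_right_comm] at hi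
  have h3 : 0 < lorentz (bdMat η) (hypMat O) * (height O (act3 (q i) O))⁻¹ :=
    mul_pos (lorentz_bdMat_hypMat_pos _ _) (inv_pos.2 (height_pos _ _))
  exact (lt_mul_iff_one_lt_right h3).1 hi

/-- In a discrete group fixing two points, few elements have bounded dilation. -/
lemma finite_abs_log_dil_le {Δ : Subgroup PSL2C} (hΔ : IsDiscreteSubgroup Δ)
    {ξ η : OnePoint ℂ} (hne : ξ ≠ η) (hξ : Δ ≤ fixS ξ) (hη : Δ ≤ fixS η) (C : ℝ) :
    {q | q ∈ Δ ∧ |Real.log (dil q ξ)| ≤ C}.Finite := by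
  by_contra hinf
  set T := {q | q ∈ Δ ∧ |Real.log (dil q ξ)| ≤ C} with hT
  have : Infinite T := Set.infinite_coe_iff.2 hinf
  have hh : Tendsto (fun q : T => height ptJ (act3 q ptJ)) (hyperfilter T) atTop :=
    (tendsto_height_cofinite hΔ ptJ Subtype.val_injective fun q : T => q.2.1).mono_left
      hyperfilter_le_cofinite
  obtain ⟨ζ, hζ⟩ := exists_tendsto_embS _ hh
  have hbd : ∀ q : T, (dil q.1 ξ)⁻¹ ≤ Real.exp C ∧ dil q.1 ξ ≤ Real.exp C := fun q => by
    have h1 := (pactMat_bdMat_of_mem_fixS (hξ q.2.1)).1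
    have h2 := abs_le.1 q.2.2
    rw [← Real.log_le_iff_le_exp (inv_pos.2 h1), ← Real.log_le_iff_le_exp h1, Real.log_inv]
    exact ⟨by linarith, h2.2⟩
  have hz : ∀ c : ℝ, Tendsto (fun q : T => c * Real.exp C * (height ptJ (act3 q ptJ))⁻¹)
      (hyperfilter T) (𝓝 0) := fun c => by
    simpa using (tendsto_inv_atTop_zero.comp hh).const_mul (c * Real.exp C)
  have key : ∀ θ, (∀ q : T, lorentz (embH ptJ (act3 q ptJ)) (bdMat θ) ≤
      lorentz (bdMat θ) (hypMat ptJ) * Real.exp C * (height ptJ (act3 q ptJ))⁻¹) → ζ = θ :=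
    fun θ hθ => lorentz_embS_bdMat_eq_zero.1 (le_antisymm
      (le_of_tendsto_of_tendsto' (tendsto_lorentz hζ tendsto_const_nhds) (hz _) hθ)
      (lorentz_embS_bdMat_nonneg _ _ _))
  refine hne ((key ξ fun q => ?_).symm.trans (key η fun q => ?_))
  · have h1 := lorentz_bdMat_hypMat_pos ξ ptJ
    have h2 := height_pos ptJ (act3 q ptJ)
    have h3 := (hbd q).1
    rw [lorentz_embH_bdMat_of_mem_fixS _ (hξ q.2.1)]
    gcongr
  · have h1 := lorentz_bdMat_hypMat_pos η ptJ
    have h2 := height_pos ptJ (act3 q ptJ)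
    have h3 := (hbd q).2
    rw [lorentz_embH_bdMat_of_mem_fixS' _ (hξ q.2.1) (hη q.2.1) hne]
    gcongr

/-- A torsion-free group with a proper homomorphism to the reals is cyclic. -/
lemma exists_forall_eq_zpow {A : Type*} [Group A] (ψ : Additive A →+ ℝ)
    (hfin : ∀ C : ℝ, {x : A | |ψ (Additive.ofMul x)| ≤ C}.Finite)
    (htf : ∀ x : A, ∀ n : ℕ, 0 < n → x ^ n = 1 → x = 1) : ∃ g : A, ∀ x, ∃ k : ℤ, x = g ^ k := by
  have hinj : ∀ x : A, ψ (Additive.ofMul x) = 0 → x = 1 := fun x hx => by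
    by_contra h1
    have h2 : Function.Injective fun n : ℕ => x ^ n := by
      rw [injective_pow_iff_not_isOfFinOrder, isOfFinOrder_iff_pow_eq_one]
      rintro ⟨n, hn, h⟩
      exact h1 (htf x n hn h)
    refine Set.infinite_range_of_injective h2 ((hfin 0).subset ?_)
    rintro _ ⟨n, rfl⟩
    simp [hx]
  obtain ⟨ε, hε, hd⟩ : ∃ ε > 0, ∀ x : A, ψ (Additive.ofMul x) ∉ Set.Ioo 0 ε := by
    have h1 : ((fun x => ψ (Additive.ofMul x)) '' {x : A | |ψ (Additive.ofMul x)| ≤ 1} \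
        {0}).Finite := ((hfin 1).image _).subset Set.sdiff_subset
    obtain ⟨ε, hε, h2⟩ := Metric.nhds_basis_ball.mem_iff.1
      (h1.isClosed.isOpen_compl.mem_nhds (fun h => h.2 rfl))
    refine ⟨min ε 1, lt_min hε one_pos, fun x hx => ?_⟩
    have h3 := hx.2.trans_le (min_le_left _ _)
    have h4 := hx.2.trans_le (min_le_right _ _)
    refine h2 (show ψ (Additive.ofMul x) ∈ Metric.ball 0 ε by
      rwa [Metric.mem_ball, dist_zero_right, Real.norm_eq_abs, abs_of_pos hx.1])
      ⟨⟨x, ?_, rfl⟩, hx.1.ne'⟩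
    rw [Set.mem_ofPred_eq, abs_of_pos hx.1]
    exact h4.le
  obtain ⟨b, hb⟩ := AddSubgroup.cyclic_of_isolated_zero (H := ψ.range) hε (by
    rw [Set.disjoint_left]
    rintro _ ⟨x, rfl⟩ hx
    exact hd x.toMul hx)
  obtain ⟨g, hg⟩ : b ∈ ψ.range := hb ▸ AddSubgroup.subset_closure rfl
  refine ⟨g.toMul, fun x => ?_⟩
  have hx : ψ (Additive.ofMul x) ∈ AddSubgroup.closure {b} := hb ▸ ⟨_, rfl⟩
  obtain ⟨k, hk⟩ := AddSubgroup.mem_closure_singleton.1 hx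
  refine ⟨k, mul_inv_eq_one.1 (hinj _ ?_)⟩
  rw [ofMul_mul, ofMul_inv, ofMul_zpow, map_add, map_neg, map_zsmul, ofMul_toMul, hg, hk,
    add_neg_cancel]

section Abelian

variable {Γ : Subgroup PSL2C} {O : H3} {ρ : Γ →* PSL2C}

/-- For abelian groups, orbit sequences converging to the same point have images converging to
the same point. -/
lemma eq_of_tendsto_of_commute (hΓ : IsKleinian Γ) (hG : IsKleinian ρ.range)
    (hρ : Function.Injective ρ) (hstp : StrictlyTypePreserving Γ ρ)
    (hab : ∀ x y : Γ, x * y = y * x) {ι : Type*} {l : Filter ι} [l.NeBot] {γ γ' : ι → Γ}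
    {ξ a a' : OnePoint ℂ} (h1 : Tendsto (fun i => embH O (act3 (γ i) O)) l (𝓝 (embS O ξ)))
    (h1' : Tendsto (fun i => embH O (act3 (γ' i) O)) l (𝓝 (embS O ξ)))
    (h2 : Tendsto (fun i => embH O (act3 (ρ (γ i)) O)) l (𝓝 (embS O a)))
    (h2' : Tendsto (fun i => embH O (act3 (ρ (γ' i)) O)) l (𝓝 (embS O a'))) : a = a' := by
  by_contra hne
  have hΓξ : ∀ g : Γ, (g : PSL2C) ∈ fixS ξ := fun g =>
    actS_eq_of_commute h1 fun i => congrArg Subtype.val (hab g (γ i))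
  have hGa : ∀ g : Γ, ρ g ∈ fixS a := fun g =>
    actS_eq_of_commute h2 fun i => by rw [← map_mul, hab, map_mul]
  have hGa' : ∀ g : Γ, ρ g ∈ fixS a' := fun g =>
    actS_eq_of_commute h2' fun i => by rw [← map_mul, hab, map_mul]
  set ψ : Additive Γ →+ ℝ :=
    (logDil a).comp (MonoidHom.toAdditive (ρ.codRestrict (fixS a) hGa)) with hψ
  have hψa : ∀ g : Γ, ψ (Additive.ofMul g) = Real.log (dil (ρ g) a) := fun g => rfl
  set χ : Additive Γ →+ ℝ :=
    (logDil ξ).comp (MonoidHom.toAdditive (Γ.subtype.codRestrict (fixS ξ) hΓξ)) with hχ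
  have hχa : ∀ g : Γ, χ (Additive.ofMul g) = Real.log (dil g ξ) := fun g => rfl
  obtain ⟨g, hg⟩ := exists_forall_eq_zpow ψ (fun C => by
      refine ((finite_abs_log_dil_le hG.1 hne (by rintro _ ⟨g, rfl⟩; exact hGa g)
        (by rintro _ ⟨g, rfl⟩; exact hGa' g) C).preimage hρ.injOn).subset fun x hx => ⟨⟨x, rfl⟩, hx⟩)
    (fun x n hn hx => Subtype.ext (hΓ.2 x x.2 n hn (congrArg Subtype.val hx)))
  have hev := eventually_one_lt_dil hne (fun i => hGa (γ i)) (fun i => hGa' (γ i)) h2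
  have hev' := eventually_one_lt_dil (Ne.symm hne) (fun i => hGa' (γ' i)) (fun i => hGa (γ' i)) h2'
  have hg1 : g ≠ 1 := by
    rintro rfl
    obtain ⟨i, hi⟩ := hev.exists
    obtain ⟨k, hk⟩ := hg (γ i)
    have h3 := Real.log_pos hi
    rw [← hψa, hk, one_zpow, ofMul_one, map_zero] at h3
    exact h3.false
  obtain ⟨η, hηξ, hη⟩ : ∃ η, ξ ≠ η ∧ actS g η = η := by
    by_contra! h
    have h3 : IsParabolic (g : PSL2C) := ⟨fun h => hg1 (Subtype.ext h), ξ, hΓξ g, fun η hη => by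
      by_contra hηξ
      exact h η (Ne.symm hηξ) hη⟩
    exact hne (((hstp g).1 h3).2.unique (hGa g) (hGa' g))
  have hΓη : ∀ x : Γ, (x : PSL2C) ∈ fixS η := fun x => by
    obtain ⟨k, rfl⟩ := hg x
    exact (fixS η).zpow_mem (mem_fixS.2 hη) k
  have hevξ := eventually_one_lt_dil hηξ (fun i => hΓξ (γ i)) (fun i => hΓη (γ i)) h1
  have hevξ' := eventually_one_lt_dil hηξ (fun i => hΓξ (γ' i)) (fun i => hΓη (γ' i)) h1'
  obtain ⟨i, hi1, hi2, hi3, hi4⟩ := (hev.and (hev'.and (hevξ.and hevξ'))).exists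
  have hprod := dil_mul_dil (hGa (γ' i)) (hGa' (γ' i)) hne
  have hpos := (pactMat_bdMat_of_mem_fixS (hGa (γ' i))).1
  have hlt : Real.log (dil (ρ (γ' i)) a) < 0 := Real.log_neg hpos (by nlinarith)
  have hi1 := Real.log_pos hi1
  have hi3 := Real.log_pos hi3
  have hi4 := Real.log_pos hi4
  obtain ⟨k, hk⟩ := hg (γ i)
  obtain ⟨k', hk'⟩ := hg (γ' i)
  rw [← hψa, hk, ofMul_zpow, map_zsmul, zsmul_eq_mul] at hi1
  rw [← hψa, hk', ofMul_zpow, map_zsmul, zsmul_eq_mul] at hlt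
  rw [← hχa, hk, ofMul_zpow, map_zsmul, zsmul_eq_mul] at hi3
  rw [← hχa, hk', ofMul_zpow, map_zsmul, zsmul_eq_mul] at hi4
  have h5 := mul_neg_of_pos_of_neg hi1 hlt
  have h6 := mul_pos hi3 hi4
  have h7 : (k : ℝ) * k' < 0 := by
    by_contra! h
    nlinarith [mul_nonneg h (sq_nonneg (ψ (Additive.ofMul g)))]
  nlinarith [mul_nonneg (neg_nonneg.2 h7.le) (sq_nonneg (χ (Additive.ofMul g)))]

end Abelian

/-! ### From the Cannon–Thurston map to the geodesic criterion -/

section Converse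

variable {Γ : Subgroup PSL2C} {O : H3} {ρ : Γ →* PSL2C} {f : OnePoint ℂ → OnePoint ℂ}

lemma tendsto_height_of_le_d3 {ι : Type*} {l : Filter ι} {x : ι → H3} {r : ι → ℝ}
    (hr : Tendsto r l atTop) (h : ∀ i, r i ≤ d3 O (x i)) :
    Tendsto (fun i => height O (x i)) l atTop := by
  refine tendsto_atTop_mono (fun i => ?_) hr
  have h1 := cosh_d3_base O (x i)
  have h2 := Real.self_le_sinh_iff.2 (d3_nonneg O (x i))
  have h3 := (Real.sinh_lt_cosh (d3 O (x i))).le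
  have h4 := height_pos O (x i)
  linarith [h i]

lemma tendsto_cofinite_of_tendsto_height {ι : Type*} {l : Filter ι} {γ : ι → Γ}
    (h : Tendsto (fun i => height O (act3 (γ i) O)) l atTop) : Tendsto γ l cofinite :=
  le_cofinite_iff_eventually_ne.2 fun g =>
    (h.eventually_gt_atTop (height O (act3 g O))).mono fun _ hi h0 => by
      rw [h0] at hi
      exact hi.false

lemma exists_radius (hΓ : IsKleinian Γ) (hG : IsKleinian ρ.range) (hρ : Function.Injective ρ)
    (hstp : StrictlyTypePreserving Γ ρ) (hne : (limitSet Γ O).Nonempty) (hf : IsCTMap Γ ρ O f)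
    (R : ℕ) : ∃ M : ℕ, ∀ γ γ' : Γ,
      (∀ p ∈ geoSeg (act3 γ O) (act3 γ' O), (M : ℝ) ≤ d3 O p) →
      ∀ p ∈ geoSeg (act3 (ρ γ) O) (act3 (ρ γ') O), (R : ℝ) ≤ d3 O p := by
  by_contra! H
  choose γ γ' hseg p hp hlt using H
  set U := hyperfilter ℕ with hU
  have hn : Tendsto (fun n : ℕ => (n : ℝ)) U atTop :=
    tendsto_natCast_atTop_atTop.mono_left Nat.hyperfilter_le_atTop
  have h1 := tendsto_height_of_le_d3 hn fun n => hseg n _ (left_mem_geoSeg _ _)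
  have h1' := tendsto_height_of_le_d3 hn fun n => hseg n _ (right_mem_geoSeg _ _)
  have hρh := tendsto_height_cofinite hG.1 O hρ fun g => ⟨g, rfl⟩
  obtain ⟨ξ, hξ⟩ := exists_tendsto_embS U h1
  obtain ⟨ξ', hξ'⟩ := exists_tendsto_embS U h1'
  obtain ⟨a, ha⟩ := exists_tendsto_embS U (hρh.comp (tendsto_cofinite_of_tendsto_height h1))
  obtain ⟨a', ha'⟩ := exists_tendsto_embS U (hρh.comp (tendsto_cofinite_of_tendsto_height h1'))
  have hξξ' : ξ = ξ' := by
    refine lorentz_embS_eq_zero.1 (tendsto_nhds_unique (tendsto_lorentz hξ hξ')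
      (squeeze_zero (fun n => (lorentz_embH_pos _ _ _).le)
        (fun n => lorentz_embH_le_of_le_d3 (Nat.cast_nonneg n) (hseg n)) ?_))
    exact tendsto_inv_atTop_zero.comp (tendsto_atTop_add_const_left _ _
      ((tendsto_pow_atTop two_ne_zero).comp hn))
  subst hξξ'
  have haa' : a = a' := by
    by_cases hab : ∀ x y : Γ, x * y = y * x
    · exact eq_of_tendsto_of_commute hΓ hG hρ hstp hab hξ hξ' ha ha'
    · exact (eq_image_of_tendsto hΓ hG hρ hf hne hab U hξ ha).trans
        (eq_image_of_tendsto hΓ hG hρ hf hne hab U hξ' ha').symm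
  have h2 := tendsto_lorentz ha ha'
  rw [lorentz_embS_eq_zero.2 haa'] at h2
  have hc : 0 < (8 * Real.cosh R ^ 2)⁻¹ := by
    have := Real.cosh_pos R
    positivity
  obtain ⟨n, hn⟩ := (h2.eventually (gt_mem_nhds hc)).exists
  exact (hlt n).not_ge (le_d3_of_lorentz_embH_lt hn _ (hp n))

theorem exists_growth (hΓ : IsKleinian Γ) (hG : IsKleinian ρ.range) (hρ : Function.Injective ρ)
    (hstp : StrictlyTypePreserving Γ ρ) (hne : (limitSet Γ O).Nonempty)
    (hf : IsCTMap Γ ρ O f) : ∃ F : ℕ → ℕ, Tendsto F atTop atTop ∧ ∀ M : ℕ, ∀ γ γ' : Γ,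
      (∀ p ∈ geoSeg (act3 γ O) (act3 γ' O), (M : ℝ) ≤ d3 O p) →
      ∀ p ∈ geoSeg (act3 (ρ γ) O) (act3 (ρ γ') O), (F M : ℝ) ≤ d3 O p := by
  classical
  have hrad := exists_radius hΓ hG hρ hstp hne hf
  set P : ℕ → ℕ → Prop := fun M R => ∀ γ γ' : Γ,
    (∀ p ∈ geoSeg (act3 γ O) (act3 γ' O), (M : ℝ) ≤ d3 O p) →
    ∀ p ∈ geoSeg (act3 (ρ γ) O) (act3 (ρ γ') O), (R : ℝ) ≤ d3 O p with hP
  refine ⟨fun M => Nat.findGreatest (P M) M, tendsto_atTop.2 fun R => ?_, fun M =>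
    Nat.findGreatest_spec (P := P M) M.zero_le fun γ γ' _ p _ => ?_⟩
  · obtain ⟨M, hM⟩ := hrad R
    filter_upwards [eventually_ge_atTop M, eventually_ge_atTop R] with N hN hR
    exact Nat.le_findGreatest hR fun γ γ' h =>
      hM γ γ' fun p hp => (Nat.cast_le.2 hN).trans (h p hp)
  · rw [Nat.cast_zero]
    exact d3_nonneg O p

end Converse

end CannonThurston

/-- **Criterion for the existence of Cannon–Thurston maps** (Theorem 3.3 of the paper).
Let `ρ : Γ → G` be a strictly type preserving isomorphism of finitely generated Kleinian
groups with `Γ` convex cocompact, and let `O ∈ ℍ³` be a base point in the convex hull of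
`Λ_Γ` not fixed by any nontrivial element of `Γ` or `G`.  Then the Cannon–Thurston map
`Λ_Γ → Λ_G` exists if and only if there is `f : ℕ → ℕ` with `f(M) → ∞` such that for
every geodesic segment `λ` in the convex hull of `Λ_Γ` with endpoints `γ·O, γ'·O` in the
orbit `Γ·O` and lying outside `B(O; M)`, the geodesic segment from `ρ(γ)·O` to `ρ(γ')·O`
lies outside `B(O; f(M))`. -/
theorem CT_existence_criterion_convex_cocompact
    (Γ : Subgroup PSL2C) (O : H3)
    (hΓKleinian : IsKleinian Γ) (hΓfg : Γ.FG)
    (hΓcc : IsConvexCocompact Γ)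
    (ρ : ↥Γ →* PSL2C)
    (hρinj : Function.Injective ρ)
    (hGKleinian : IsKleinian ρ.range) (hGfg : ρ.range.FG)
    (hstp : StrictlyTypePreserving Γ ρ)
    (hOΓ : ∀ g ∈ Γ, g ≠ 1 → act3 g O ≠ O)
    (hOG : ∀ g ∈ ρ.range, g ≠ 1 → act3 g O ≠ O)
    (hOhull : O ∈ convexHullOfLimitSet Γ O) :
    (∃ f : OnePoint ℂ → OnePoint ℂ, IsCTMap Γ ρ O f) ↔
      ∃ f : ℕ → ℕ, Filter.Tendsto f Filter.atTop Filter.atTop ∧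
        ∀ M : ℕ, ∀ γ γ' : ↥Γ,
          geoSeg (act3 (↑γ) O) (act3 (↑γ') O) ⊆ convexHullOfLimitSet Γ O →
          (∀ p ∈ geoSeg (act3 (↑γ) O) (act3 (↑γ') O), (M : ℝ) ≤ d3 O p) →
          ∀ p ∈ geoSeg (act3 (ρ γ) O) (act3 (ρ γ') O), (f M : ℝ) ≤ d3 O p := by
  refine ⟨fun ⟨f, hf⟩ => ?_, fun ⟨F, hF, H⟩ => ?_⟩
  · obtain ⟨F, hF, H⟩ := CannonThurston.exists_growth hΓKleinian hGKleinian hρinj hstp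
      (CannonThurston.limitSet_nonempty hOhull) hf
    exact ⟨F, hF, fun M γ γ' _ => H M γ γ'⟩
  · exact CannonThurston.exists_isCTMap hF fun M γ γ' =>
      H M γ γ' (CannonThurston.geoSeg_subset_convexHullOfLimitSet hOhull γ γ')
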